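/- arXiv:2302.04668 — 2 statements merged into one kernel-verified Lean document; each statement's English description precedes it below -/
import Mathlib

section
/- The equational theory of the time warp algebra is decidable: the predicate on pairs of terms (s, t) given by 'eval h s = eval h t for every assignment h : ℕ → W of time warps to variables' is a computable (decidable by an algorithm) predicate, with respect to a canonical encoding of terms as natural numbers. -/
/-- A map `f : ℕ∞ → ℕ∞` preserves arbitrary suprema. -/
def PreservesSSup (f : ℕ∞ → ℕ∞) : Prop :=
  ∀ S : Set ℕ∞, f (sSup S) = sSup (f '' S)

/-- The predecessor time warp: `pred 0 = 0`, `pred ⊤ = ⊤`, `pred (n+1) = n`. -/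
def wpred (m : ℕ∞) : ℕ∞ := if m = ⊤ then ⊤ else ((m.toNat - 1 : ℕ) : ℕ∞)

/-- The involution `f⋆` of a time warp `f`: `f⋆ m = ⨅ {pred n | n ∈ ℕ∞, m ≤ f n}`. -/
noncomputable def winv (f : ℕ∞ → ℕ∞) : ℕ∞ → ℕ∞ :=
  fun m => sInf {y | ∃ n : ℕ∞, m ≤ f n ∧ y = wpred n}

/-- Terms in the language of the time warp algebra. -/
inductive Term : Type
  | var : ℕ → Term
  | one : Term
  | mul : Term → Term → Term
  | star : Term → Term
  | meet : Term → Term → Term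
  | join : Term → Term → Term

/-- Evaluation of a term under an assignment `h` of maps to variables. -/
noncomputable def eval (h : ℕ → ℕ∞ → ℕ∞) : Term → ℕ∞ → ℕ∞
  | Term.var i => h i
  | Term.one => id
  | Term.mul t u => eval h t ∘ eval h u
  | Term.star t => winv (eval h t)
  | Term.meet t u => fun x => eval h t x ⊓ eval h u x
  | Term.join t u => fun x => eval h t x ⊔ eval h u x

/-- A canonical (primitive-recursive) encoding of terms as natural numbers. -/
def Term.encode : Term → ℕ
  | Term.var i => Nat.pair 0 i
  | Term.one => Nat.pair 1 0
  | Term.mul t u => Nat.pair 2 (Nat.pair t.encode u.encode)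
  | Term.star t => Nat.pair 3 t.encode
  | Term.meet t u => Nat.pair 4 (Nat.pair t.encode u.encode)
  | Term.join t u => Nat.pair 5 (Nat.pair t.encode u.encode)


/-! ### Time warps -/

/-- An elementary description of sup-preserving maps on `ℕ∞`. -/
structure IsTimeWarp (f : ℕ∞ → ℕ∞) : Prop where
  mono : Monotone f
  zero : f 0 = 0
  exists_lt : ∀ a < f ⊤, ∃ k : ℕ, a < f k

lemma PreservesSSup.isTimeWarp {f : ℕ∞ → ℕ∞} (hf : PreservesSSup f) : IsTimeWarp f where
  mono a b hab := by
    have h := hf {a, b}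
    rw [sSup_pair, Set.image_pair, sSup_pair, sup_eq_right.2 hab] at h
    rw [h]
    exact le_sup_left
  zero := by
    have h := hf ∅
    simpa using h
  exists_lt a ha := by
    have h := hf (Set.range ((↑) : ℕ → ℕ∞))
    have h' : sSup (Set.range ((↑) : ℕ → ℕ∞)) = ⊤ := ENat.iSup_natCast
    rw [h'] at h
    rw [h, lt_sSup_iff] at ha
    obtain ⟨_, ⟨_, ⟨k, rfl⟩, rfl⟩, hk⟩ := ha
    exact ⟨k, hk⟩

lemma IsTimeWarp.preservesSSup {f : ℕ∞ → ℕ∞} (hf : IsTimeWarp f) : PreservesSSup f := by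
  intro S
  refine le_antisymm (le_of_forall_lt fun a ha => ?_) ?_
  · have key : ∃ b < sSup S, a < f b ∨ ∃ b ∈ S, a < f b := by
      by_cases hS : sSup S ∈ S
      · by_cases h0 : sSup S = 0
        · rw [h0, hf.zero] at ha
          exact absurd ha not_lt_zero
        · exact ⟨0, pos_iff_ne_zero.2 h0, Or.inr ⟨_, hS, ha⟩⟩
      · rcases S.eq_empty_or_nonempty with rfl | hne
        · rw [sSup_empty, bot_eq_zero, hf.zero] at ha
          exact absurd ha not_lt_zero
        · have := hne.to_subtype
          have htop : sSup S = ⊤ := by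
            by_contra h
            exact hS (ENat.sSup_mem_of_nonempty_of_lt_top (lt_top_iff_ne_top.2 h))
          rw [htop] at ha
          obtain ⟨k, hk⟩ := hf.exists_lt a ha
          exact ⟨k, htop ▸ ENat.natCast_lt_top k, Or.inl hk⟩
    obtain ⟨b, hb, h | ⟨b, hb, h⟩⟩ := key
    · obtain ⟨s, hs, hbs⟩ := lt_sSup_iff.1 hb
      exact lt_sSup_iff.2 ⟨_, ⟨s, hs, rfl⟩, h.trans_le (hf.mono hbs.le)⟩
    · exact lt_sSup_iff.2 ⟨_, ⟨b, hb, rfl⟩, h⟩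
  · refine sSup_le ?_
    rintro _ ⟨s, hs, rfl⟩
    exact hf.mono (le_sSup hs)

/-- A map is finitary if it sends finite arguments to finite values. -/
def Finitary (f : ℕ∞ → ℕ∞) : Prop := ∀ k : ℕ, f k < ⊤

lemma wpred_top : wpred ⊤ = ⊤ := if_pos rfl

lemma wpred_natCast (n : ℕ) : wpred n = ((n - 1 : ℕ) : ℕ∞) := by
  simp [wpred]

lemma winv_zero (f : ℕ∞ → ℕ∞) : winv f 0 = 0 := by
  refine le_antisymm (sInf_le ⟨0, zero_le, ?_⟩) zero_le
  simpa using (wpred_natCast 0).symm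

lemma winv_monotone (f : ℕ∞ → ℕ∞) : Monotone (winv f) := by
  intro a b hab
  refine sInf_le_sInf ?_
  rintro _ ⟨n, hn, rfl⟩
  exact ⟨n, hab.trans hn, rfl⟩

lemma le_winv {f : ℕ∞ → ℕ∞} (hf : Monotone f) {m : ℕ∞} {n : ℕ} (h : f n < m) :
    (n : ℕ∞) ≤ winv f m := by
  refine le_sInf ?_
  rintro _ ⟨k, hk, rfl⟩
  have hnk : (n : ℕ∞) < k := hf.reflect_lt (h.trans_le hk)
  induction k using ENat.recTopCoe with
  | top => rw [wpred_top]; exact le_top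
  | coe k =>
    rw [wpred_natCast]
    norm_cast at hnk ⊢
    omega

lemma winv_eq_natCast {f : ℕ∞ → ℕ∞} (hf : Monotone f) {m : ℕ∞} {n : ℕ} (h : f n < m)
    (h' : m ≤ f (n + 1)) : winv f m = n := by
  refine le_antisymm (sInf_le ⟨n + 1, h', ?_⟩) (le_winv hf h)
  simpa using (wpred_natCast (n + 1)).symm

lemma winv_eq_top {f : ℕ∞ → ℕ∞} (hf : Monotone f) {m : ℕ∞} (h : f ⊤ < m) :
    winv f m = ⊤ := by
  refine sInf_eq_top.2 ?_
  rintro _ ⟨k, hk, rfl⟩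
  exact absurd (h.trans_le (hk.trans (hf le_top))) (lt_irrefl _)

lemma winv_top_of_finitary {f : ℕ∞ → ℕ∞} (hf : Finitary f) : winv f ⊤ = ⊤ := by
  refine sInf_eq_top.2 ?_
  rintro _ ⟨k, hk, rfl⟩
  induction k using ENat.recTopCoe with
  | top => exact wpred_top
  | coe k => exact absurd (hf k) (not_lt_of_ge hk)

namespace IsTimeWarp

variable {f g : ℕ∞ → ℕ∞}

lemma winv_cases (hf : IsTimeWarp f) (m : ℕ∞) :
    m = 0 ∨ (∃ n : ℕ, f n < m ∧ m ≤ f (n + 1)) ∨ f ⊤ < m ∨ (m = ⊤ ∧ Finitary f) := by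
  by_cases h0 : m = 0
  · exact Or.inl h0
  by_cases hk : ∃ k : ℕ, m ≤ f k
  · classical
    refine Or.inr (Or.inl ?_)
    have hs := Nat.find_spec hk
    have hm := fun j => Nat.find_min (m := j) hk
    generalize Nat.find hk = k at hs hm
    cases k with
    | zero =>
      rw [Nat.cast_zero, hf.zero] at hs
      exact absurd (le_antisymm hs zero_le) h0
    | succ n => exact ⟨n, not_le.1 (hm n n.lt_succ_self), by simpa using hs⟩
  · push Not at hk
    rcases lt_or_ge (f ⊤) m with h | h
    · exact Or.inr (Or.inr (Or.inl h))
    · have hm : m = ⊤ := by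
        by_contra hm
        obtain ⟨m, rfl⟩ := ENat.ne_top_iff_exists.1 hm
        cases m with
        | zero => exact h0 rfl
        | succ m =>
          obtain ⟨k, hk'⟩ := hf.exists_lt m (lt_of_lt_of_le (by norm_cast; omega) h)
          refine absurd (hk k) (not_lt_of_ge ?_)
          simpa using Order.add_one_le_of_lt hk'
      exact Or.inr (Or.inr (Or.inr ⟨hm, fun k => hm ▸ hk k⟩))

lemma finitary_of_lt_top (hf : IsTimeWarp f) (h : f ⊤ < ⊤) : Finitary f :=
  fun _ => (hf.mono le_top).trans_lt h

protected lemma id : IsTimeWarp id where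
  mono := monotone_id
  zero := rfl
  exists_lt a ha := by
    obtain ⟨n, rfl⟩ := ENat.ne_top_iff_exists.1 ha.ne
    exact ⟨n + 1, by simp only [id]; norm_cast; omega⟩

protected lemma comp (hf : IsTimeWarp f) (hg : IsTimeWarp g) : IsTimeWarp (f ∘ g) := by
  refine ⟨hf.mono.comp hg.mono, by simp [hf.zero, hg.zero], fun a ha => ?_⟩
  by_cases h : g ⊤ = ⊤
  · simp only [Function.comp, h] at ha
    obtain ⟨k, hk⟩ := hf.exists_lt a ha
    obtain ⟨j, hj⟩ := hg.exists_lt k (by rw [h]; exact ENat.natCast_lt_top k)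
    exact ⟨j, hk.trans_le (hf.mono hj.le)⟩
  · obtain ⟨c, hc⟩ := ENat.ne_top_iff_exists.1 h
    cases c with
    | zero =>
      simp only [Function.comp, ← hc, Nat.cast_zero, hf.zero] at ha
      exact absurd ha not_lt_zero
    | succ c =>
      obtain ⟨k, hk⟩ := hg.exists_lt c (by rw [← hc]; norm_cast; omega)
      refine ⟨k, ha.trans_le (hf.mono ?_)⟩
      rw [← hc]
      simpa using Order.add_one_le_of_lt hk

protected lemma inf (hf : IsTimeWarp f) (hg : IsTimeWarp g) :
    IsTimeWarp fun x => f x ⊓ g x where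
  mono _ _ h := inf_le_inf (hf.mono h) (hg.mono h)
  zero := by simp [hf.zero]
  exists_lt a ha := by
    obtain ⟨h1, h2⟩ := lt_inf_iff.1 ha
    obtain ⟨j, hj⟩ := hf.exists_lt a h1
    obtain ⟨k, hk⟩ := hg.exists_lt a h2
    refine ⟨max j k, lt_inf_iff.2 ⟨hj.trans_le (hf.mono ?_), hk.trans_le (hg.mono ?_)⟩⟩ <;>
      norm_cast <;> omega

protected lemma sup (hf : IsTimeWarp f) (hg : IsTimeWarp g) :
    IsTimeWarp fun x => f x ⊔ g x where
  mono _ _ h := sup_le_sup (hf.mono h) (hg.mono h)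
  zero := by simp [hf.zero, hg.zero]
  exists_lt a ha := by
    rcases lt_sup_iff.1 ha with h | h
    · obtain ⟨j, hj⟩ := hf.exists_lt a h
      exact ⟨j, lt_sup_iff.2 (Or.inl hj)⟩
    · obtain ⟨j, hj⟩ := hg.exists_lt a h
      exact ⟨j, lt_sup_iff.2 (Or.inr hj)⟩

protected lemma winv (hf : IsTimeWarp f) : IsTimeWarp (winv f) where
  mono := winv_monotone f
  zero := winv_zero f
  exists_lt a ha := by
    rcases hf.winv_cases ⊤ with h | ⟨n, h, h'⟩ | h | ⟨-, h⟩
    · exact absurd h ENat.top_ne_zero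
    · obtain ⟨j, hj⟩ := ENat.ne_top_iff_exists.1 h.ne
      rw [winv_eq_natCast hf.mono h h'] at ha
      refine ⟨j + 1, ?_⟩
      rwa [winv_eq_natCast hf.mono (n := n) (by rw [← hj]; norm_cast; omega) (le_top.trans h')]
    · obtain ⟨j, hj⟩ := ENat.ne_top_iff_exists.1 h.ne
      refine ⟨j + 1, ?_⟩
      rw [winv_eq_top hf.mono (by rw [← hj]; norm_cast; omega)]
      exact ha.trans_le le_top
    · obtain ⟨b, rfl⟩ := ENat.ne_top_iff_exists.1 (ha.trans_le le_top).ne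
      obtain ⟨j, hj⟩ := ENat.ne_top_iff_exists.1 (h (b + 1)).ne
      refine ⟨j + 1, lt_of_lt_of_le ?_ (le_winv hf.mono (n := b + 1) ?_)⟩
      · norm_cast; omega
      · rw [← hj]; norm_cast; omega

lemma finitary_comp_iff (hf : IsTimeWarp f) (hg : IsTimeWarp g) :
    Finitary (f ∘ g) ↔ f (g ⊤) < ⊤ ∨ (Finitary f ∧ Finitary g) := by
  constructor
  · intro h
    by_contra! hc
    obtain ⟨h1, h2⟩ := hc
    have h1 : f (g ⊤) = ⊤ := top_le_iff.1 h1
    have hgf : Finitary g := by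
      intro k
      by_contra hk
      have := h k
      rw [Function.comp, top_le_iff.1 (not_lt.1 hk)] at this
      exact absurd (this.trans_le (h1.ge.trans (hf.mono le_top))) (lt_irrefl _)
    refine h2 ?_ hgf
    intro k
    rcases lt_or_ge (k : ℕ∞) (g ⊤) with hk | hk
    · obtain ⟨j, hj⟩ := hg.exists_lt k hk
      exact (hf.mono hj.le).trans_lt (h j)
    · obtain ⟨c, hc⟩ := ENat.ne_top_iff_exists.1 (hk.trans_lt (ENat.natCast_lt_top k)).ne
      have : ∃ j : ℕ, (c : ℕ∞) ≤ g j := by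
        cases c with
        | zero => exact ⟨0, zero_le⟩
        | succ c =>
          obtain ⟨j, hj⟩ := hg.exists_lt c (by rw [← hc]; norm_cast; omega)
          exact ⟨j, by simpa using Order.add_one_le_of_lt hj⟩
      obtain ⟨j, hj⟩ := this
      exact absurd ((hf.mono hj).trans_lt (h j)) (by rw [hc, h1]; exact lt_irrefl _)
  · rintro (h | ⟨h1, h2⟩)
    · exact (hf.comp hg).finitary_of_lt_top h
    · intro k
      obtain ⟨j, hj⟩ := ENat.ne_top_iff_exists.1 (h2 k).ne
      rw [Function.comp, ← hj]
      exact h1 j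

lemma finitary_inf_iff (hf : IsTimeWarp f) (hg : IsTimeWarp g) :
    Finitary (fun x => f x ⊓ g x) ↔ Finitary f ∨ Finitary g := by
  constructor
  · intro h
    by_contra! hc
    simp only [Finitary, not_forall, not_lt, top_le_iff] at hc
    obtain ⟨⟨j, hj⟩, ⟨k, hk⟩⟩ := hc
    have hmax := h (max j k)
    rw [inf_lt_iff] at hmax
    rcases hmax with hm | hm
    · refine absurd ((hf.mono (a := (j : ℕ∞)) ?_).trans_lt hm) (by simp [hj])
      norm_cast; omega
    · refine absurd ((hg.mono (a := (k : ℕ∞)) ?_).trans_lt hm) (by simp [hk])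
      norm_cast; omega
  · rintro (h | h) k
    · exact inf_lt_iff.2 (Or.inl (h k))
    · exact inf_lt_iff.2 (Or.inr (h k))

lemma finitary_winv_iff (hf : IsTimeWarp f) : Finitary (winv f) ↔ f ⊤ = ⊤ := by
  constructor
  · intro h
    by_contra hc
    obtain ⟨j, hj⟩ := ENat.ne_top_iff_exists.1 hc
    have := h (j + 1)
    rw [winv_eq_top hf.mono (by rw [← hj]; norm_cast; omega)] at this
    exact absurd this (lt_irrefl _)
  · intro h k
    rcases hf.winv_cases k with h' | ⟨n, h', h''⟩ | h' | ⟨h', -⟩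
    · rw [h', winv_zero]; exact ENat.natCast_lt_top 0
    · rw [winv_eq_natCast hf.mono h' h'']; exact ENat.natCast_lt_top n
    · exact absurd h' (by simp [h])
    · exact absurd h' (ENat.natCast_ne_top k)

end IsTimeWarp

lemma finitary_sup_iff {f g : ℕ∞ → ℕ∞} :
    Finitary (fun x => f x ⊔ g x) ↔ Finitary f ∧ Finitary g := by
  simp only [Finitary, sup_lt_iff, forall_and]

lemma isTimeWarp_eval {h : ℕ → ℕ∞ → ℕ∞} (hh : ∀ i, IsTimeWarp (h i)) (t : Term) :
    IsTimeWarp (eval h t) := by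
  induction t with
  | var i => exact hh i
  | one => exact IsTimeWarp.id
  | mul t u ht hu => exact ht.comp hu
  | star t ht => exact ht.winv
  | meet t u ht hu => exact ht.inf hu
  | join t u ht hu => exact ht.sup hu

/-! ### Certificates

A certificate records finitely many facts `V e x y` (the term with code `e` sends `x` to `y`) and
`F e` (the term with code `e` is finitary), each justified by facts about immediate subterms. -/

/-- The code of the left immediate subterm of a binary term with code `e`. -/
def leftCode (e : ℕ) : ℕ := e.unpair.2.unpair.1

/-- The code of the right immediate subterm of a binary term with code `e`. -/
def rightCode (e : ℕ) : ℕ := e.unpair.2.unpair.2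

section Rules

variable {α : Type*} [LinearOrder α] [Zero α] [One α] [Add α]

/-- The ways of justifying that the involution of the term with code `a` sends `x` to `y`. -/
def StarRule (top : α) (V : ℕ → α → α → Prop) (F : ℕ → Prop) (a : ℕ) (x y : α) : Prop :=
  (x = 0 ∧ y = 0) ∨
  (y + 1 < top ∧ ∃ u w, V a y u ∧ V a (y + 1) w ∧ u < x ∧ x ≤ w) ∨
  (y = top ∧ ∃ u, V a top u ∧ u < x) ∨
  (x = top ∧ y = top ∧ F a)

/-- The ways of justifying that the term with code `e` sends `x` to `y`. -/
def EvalRule (top : α) (V : ℕ → α → α → Prop) (F : ℕ → Prop) (e : ℕ) (x y : α) : Prop :=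
  e.unpair.1 = 0 ∨
  (e.unpair.1 = 1 ∧ e.unpair.2 = 0 ∧ y = x) ∨
  (e.unpair.1 = 2 ∧ ∃ z, V (rightCode e) x z ∧ V (leftCode e) z y) ∨
  (e.unpair.1 = 3 ∧ V e.unpair.2 0 0 ∧ StarRule top V F e.unpair.2 x y) ∨
  (e.unpair.1 = 4 ∧ ∃ u w, V (leftCode e) x u ∧ V (rightCode e) x w ∧ y = min u w) ∨
  (e.unpair.1 = 5 ∧ ∃ u w, V (leftCode e) x u ∧ V (rightCode e) x w ∧ y = max u w)

/-- The ways of justifying that the term with code `e` is finitary. -/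
def FinRule (top : α) (V : ℕ → α → α → Prop) (F : ℕ → Prop) (e : ℕ) : Prop :=
  (∃ u, V e top u ∧ u < top) ∨
  e.unpair.1 = 0 ∨
  e.unpair.1 = 1 ∨
  (e.unpair.1 = 2 ∧ F (leftCode e) ∧ F (rightCode e)) ∨
  (e.unpair.1 = 3 ∧ V e.unpair.2 top top) ∨
  (e.unpair.1 = 4 ∧ (F (leftCode e) ∨ F (rightCode e))) ∨
  (e.unpair.1 = 5 ∧ F (leftCode e) ∧ F (rightCode e))

/-- A collection of facts that are all justified and whose facts about variables are consistent. -/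
structure IsCertificate (top : α) (V : ℕ → α → α → Prop) (F : ℕ → Prop) : Prop where
  top_pos : 0 < top
  le_top : ∀ e x y, V e x y → x ≤ top ∧ y ≤ top
  evalRule : ∀ e x y, V e x y → EvalRule top V F e x y
  finRule : ∀ e, F e → FinRule top V F e
  var_mono : ∀ e x y x' y', V e x y → V e x' y' → e.unpair.1 = 0 → x ≤ x' → y ≤ y'
  var_zero : ∀ e y, V e 0 y → e.unpair.1 = 0 → y = 0
  var_fin : ∀ e x y, V e x y → F e → e.unpair.1 = 0 → x < top → y < top

end Rules

/-- Interpret a natural number `x ≤ M` as an element of `ℕ∞`, with `M` playing the role of `⊤`. -/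
def decodeTop (M x : ℕ) : ℕ∞ := if x < M then x else ⊤

lemma decodeTop_of_lt {M x : ℕ} (h : x < M) : decodeTop M x = x := if_pos h

lemma decodeTop_self (M : ℕ) : decodeTop M M = ⊤ := if_neg (lt_irrefl M)

lemma decodeTop_lt_iff {M x y : ℕ} (hy : y ≤ M) (hx : x ≤ M) :
    decodeTop M x < decodeTop M y ↔ x < y := by
  rcases hy.lt_or_eq with hy | rfl <;> rcases hx.lt_or_eq with hx | rfl <;>
    simp only [decodeTop_of_lt, decodeTop_self, *] <;> simp [*]

lemma decodeTop_le_iff {M x y : ℕ} (hx : x ≤ M) (hy : y ≤ M) :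
    decodeTop M x ≤ decodeTop M y ↔ x ≤ y := by
  rw [← not_lt, decodeTop_lt_iff hx hy, not_lt]

lemma decodeTop_monotone (M : ℕ) : Monotone (decodeTop M) := by
  intro x y h
  unfold decodeTop
  split_ifs with h1 h2
  · exact_mod_cast h
  · exact le_top
  · omega
  · exact le_rfl

/-- The time warp extending the finitely many samples in `V` for the term with code `e`. -/
noncomputable def extendSamples (M : ℕ) (V : ℕ → ℕ → ℕ → Prop) (e : ℕ) (x : ℕ∞) : ℕ∞ :=
  sInf {z | ∃ b, V e M b ∧ z = decodeTop M b} ⊓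
    (sSup {z | ∃ a b, V e a b ∧ decodeTop M a ≤ x ∧ z = decodeTop M b} ⊔
      if (M : ℕ∞) ≤ x then x else 0)

namespace IsCertificate

variable {M : ℕ} {V : ℕ → ℕ → ℕ → Prop} {F : ℕ → Prop} {e : ℕ}

lemma isTimeWarp_extendSamples (hC : IsCertificate M V F) (he : e.unpair.1 = 0) :
    IsTimeWarp (extendSamples M V e) where
  mono x y hxy := by
    refine inf_le_inf le_rfl (sup_le_sup (sSup_le_sSup ?_) ?_)
    · rintro _ ⟨a, b, h, hx, rfl⟩
      exact ⟨a, b, h, hx.trans hxy, rfl⟩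
    · split_ifs with h1 h2
      · exact hxy
      · exact absurd (h1.trans hxy) h2
      · exact zero_le
      · exact le_rfl
  zero := by
    refine le_antisymm (inf_le_right.trans (sup_le (sSup_le ?_) ?_)) zero_le
    · rintro _ ⟨a, b, h, ha, rfl⟩
      have h0 : a = 0 := by
        have h0 : (0 : ℕ∞) = decodeTop M 0 := by rw [decodeTop_of_lt hC.top_pos]; rfl
        rw [h0, decodeTop_le_iff (hC.le_top _ _ _ h).1 hC.top_pos.le] at ha
        exact Nat.le_zero.1 ha
      subst h0
      rw [hC.var_zero e b h he, decodeTop_of_lt hC.top_pos]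
      rfl
    · split_ifs <;> exact le_rfl
  exists_lt a ha := by
    have ha' : a < sInf {z | ∃ b, V e M b ∧ z = decodeTop M b} := ha.trans_le inf_le_left
    obtain ⟨n, rfl⟩ := ENat.ne_top_iff_exists.1 (ha.trans_le _root_.le_top).ne
    refine ⟨max M (n + 1), lt_inf_iff.2 ⟨ha', lt_sup_iff.2 (Or.inr ?_)⟩⟩
    rw [if_pos (by norm_cast; omega)]
    norm_cast
    omega

lemma extendSamples_decodeTop (hC : IsCertificate M V F) (he : e.unpair.1 = 0) {x y : ℕ}
    (h : V e x y) : extendSamples M V e (decodeTop M x) = decodeTop M y := by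
  obtain ⟨hx, hy⟩ := hC.le_top _ _ _ h
  refine le_antisymm ?_ (le_inf (le_sInf ?_) (le_sup_of_le_left (le_sSup ⟨x, y, h, le_rfl, rfl⟩)))
  · rcases hx.lt_or_eq with hx' | rfl
    · refine inf_le_right.trans (sup_le (sSup_le ?_) ?_)
      · rintro _ ⟨a, b, h', ha, rfl⟩
        rw [decodeTop_le_iff (hC.le_top _ _ _ h').1 hx] at ha
        exact decodeTop_monotone M (hC.var_mono _ _ _ _ _ h' h he ha)
      · rw [if_neg]
        · exact zero_le
        · rw [decodeTop_of_lt hx']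
          norm_cast
          omega
    · exact inf_le_left.trans (sInf_le ⟨y, h, rfl⟩)
  · rintro _ ⟨b, h', rfl⟩
    exact decodeTop_monotone M (hC.var_mono _ _ _ _ _ h h' he hx)

lemma finitary_extendSamples (hC : IsCertificate M V F) (he : e.unpair.1 = 0) (h : F e) :
    Finitary (extendSamples M V e) := by
  intro k
  refine inf_le_right.trans_lt (sup_lt_iff.2 ⟨?_, ?_⟩)
  · refine lt_of_le_of_lt (sSup_le ?_) (ENat.natCast_lt_top M)
    rintro _ ⟨a, b, h', ha, rfl⟩
    have haM : a < M := by
      rcases (hC.le_top _ _ _ h').1.lt_or_eq with hlt | rfl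
      · exact hlt
      · rw [decodeTop_self] at ha
        exact absurd (top_le_iff.1 ha) (ENat.natCast_ne_top k)
    have hb := hC.var_fin _ _ _ h' h he haM
    rw [decodeTop_of_lt hb]
    exact_mod_cast hb.le
  · split_ifs
    · exact ENat.natCast_lt_top k
    · exact ENat.natCast_lt_top 0

/-- A code about which a certificate records a value is the code of a term. -/
lemma exists_encode_eq (hC : IsCertificate M V F) (e : ℕ) :
    ∀ x y, V e x y → ∃ t : Term, e = t.encode := by
  induction e using Nat.strong_induction_on with
  | _ e ih =>
  intro x y h
  have hpair : e = Nat.pair e.unpair.1 e.unpair.2 := (Nat.pair_unpair e).symm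
  have hpair' : e.unpair.2 = Nat.pair (leftCode e) (rightCode e) := (Nat.pair_unpair _).symm
  have hlt : e.unpair.1 ≠ 0 → e.unpair.2 < e := by
    intro h0
    have := Nat.unpair_add_le e
    omega
  have hleft : e.unpair.1 ≠ 0 → leftCode e < e := fun h0 =>
    (Nat.unpair_left_le _).trans_lt (hlt h0)
  have hright : e.unpair.1 ≠ 0 → rightCode e < e := fun h0 =>
    (Nat.unpair_right_le _).trans_lt (hlt h0)
  rcases hC.evalRule e x y h with h | ⟨h, h', -⟩ | ⟨h, z, h1, h2⟩ | ⟨h, h', -⟩ |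
    ⟨h, u, w, h1, h2, -⟩ | ⟨h, u, w, h1, h2, -⟩
  · exact ⟨Term.var e.unpair.2, by rw [hpair, h]; simp [Term.encode]⟩
  · exact ⟨Term.one, by rw [hpair, h, h']; rfl⟩
  · obtain ⟨s, hs⟩ := ih _ (hleft (by omega)) _ _ h2
    obtain ⟨t, ht⟩ := ih _ (hright (by omega)) _ _ h1
    exact ⟨Term.mul s t, by rw [hpair, hpair', h, hs, ht]; rfl⟩
  · obtain ⟨s, hs⟩ := ih _ (hlt (by omega)) _ _ h'
    exact ⟨Term.star s, by rw [hpair, h, hs]; rfl⟩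
  · obtain ⟨s, hs⟩ := ih _ (hleft (by omega)) _ _ h1
    obtain ⟨t, ht⟩ := ih _ (hright (by omega)) _ _ h2
    exact ⟨Term.meet s t, by rw [hpair, hpair', h, hs, ht]; rfl⟩
  · obtain ⟨s, hs⟩ := ih _ (hleft (by omega)) _ _ h1
    obtain ⟨t, ht⟩ := ih _ (hright (by omega)) _ _ h2
    exact ⟨Term.join s t, by rw [hpair, hpair', h, hs, ht]; rfl⟩

/-- The facts recorded in a certificate hold for the assignment extending its samples. -/
lemma sound (hC : IsCertificate M V F) (t : Term) :
    (∀ x y, V t.encode x y → eval (fun i => extendSamples M V (Nat.pair 0 i)) t (decodeTop M x) =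
      decodeTop M y) ∧
    (F t.encode → Finitary (eval (fun i => extendSamples M V (Nat.pair 0 i)) t)) := by
  have hh : ∀ i, IsTimeWarp (extendSamples M V (Nat.pair 0 i)) := fun i =>
    hC.isTimeWarp_extendSamples (by simp)
  have htw := isTimeWarp_eval hh
  have hfin : ∀ t : Term, (∀ x y, V t.encode x y →
      eval (fun i => extendSamples M V (Nat.pair 0 i)) t (decodeTop M x) = decodeTop M y) →
      (∃ u, V t.encode M u ∧ u < M) →
      Finitary (eval (fun i => extendSamples M V (Nat.pair 0 i)) t) := by
    rintro t ht ⟨u, hu, huM⟩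
    refine (htw t).finitary_of_lt_top ?_
    rw [← decodeTop_self M, ht _ _ hu, decodeTop_lt_iff le_rfl huM.le]
    exact huM
  induction t with
  | var i =>
    exact ⟨fun x y h => hC.extendSamples_decodeTop (e := Nat.pair 0 i) (by simp) h,
      hC.finitary_extendSamples (e := Nat.pair 0 i) (by simp)⟩
  | one =>
    refine ⟨fun x y h => ?_, fun _ => fun k => ENat.natCast_lt_top k⟩
    have := hC.evalRule _ _ _ h
    simp only [EvalRule, Term.encode, Nat.unpair_pair] at this
    simp at this
    rw [this]
    rfl
  | mul s t hs ht =>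
    have hval : ∀ x y, V (Term.mul s t).encode x y →
        eval (fun i => extendSamples M V (Nat.pair 0 i)) (Term.mul s t) (decodeTop M x) =
          decodeTop M y := by
      intro x y h
      have := hC.evalRule _ _ _ h
      simp [EvalRule, leftCode, rightCode, Term.encode] at this
      obtain ⟨z, h1, h2⟩ := this
      rw [eval, Function.comp, ht.1 _ _ h1, hs.1 _ _ h2]
    refine ⟨hval, fun h => ?_⟩
    rcases hC.finRule _ h with h | h
    · exact hfin _ hval h
    · simp [leftCode, rightCode, Term.encode] at h
      exact ((htw s).finitary_comp_iff (htw t)).2 (Or.inr ⟨hs.2 h.1, ht.2 h.2⟩)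
  | star s hs =>
    have hval : ∀ x y, V (Term.star s).encode x y →
        eval (fun i => extendSamples M V (Nat.pair 0 i)) (Term.star s) (decodeTop M x) =
          decodeTop M y := by
      intro x y h
      have hle := hC.le_top _ _ _ h
      have := hC.evalRule _ _ _ h
      simp [EvalRule, leftCode, rightCode, Term.encode] at this
      rw [eval]
      rcases this.2 with ⟨rfl, rfl⟩ | ⟨hy, u, w, h1, h2, hux, hxw⟩ | ⟨rfl, u, h1, hux⟩ |
        ⟨rfl, rfl, h1⟩
      · rw [decodeTop_of_lt hC.top_pos, Nat.cast_zero, winv_zero]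
      · have e1 := hs.1 _ _ h1
        have e2 := hs.1 _ _ h2
        have hyM : y < M := by omega
        rw [decodeTop_of_lt hyM] at e1 ⊢
        rw [decodeTop_of_lt hy] at e2
        refine winv_eq_natCast (htw s).mono ?_ ?_
        · rw [e1, decodeTop_lt_iff hle.1 (hC.le_top _ _ _ h1).2]
          exact hux
        · rw [← Nat.cast_one, ← Nat.cast_add, e2]
          exact decodeTop_monotone M hxw
      · have e1 := hs.1 _ _ h1
        rw [decodeTop_self] at e1 ⊢
        refine winv_eq_top (htw s).mono ?_
        rw [e1, decodeTop_lt_iff hle.1 (hC.le_top _ _ _ h1).2]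
        exact hux
      · rw [decodeTop_self]
        exact winv_top_of_finitary (hs.2 h1)
    refine ⟨hval, fun h => ?_⟩
    rcases hC.finRule _ h with h | h
    · exact hfin _ hval h
    · simp [leftCode, rightCode, Term.encode] at h
      refine ((htw s).finitary_winv_iff).2 ?_
      have := hs.1 _ _ h
      rwa [decodeTop_self] at this
  | meet s t hs ht =>
    have hval : ∀ x y, V (Term.meet s t).encode x y →
        eval (fun i => extendSamples M V (Nat.pair 0 i)) (Term.meet s t) (decodeTop M x) =
          decodeTop M y := by
      intro x y h
      have := hC.evalRule _ _ _ h
      simp [EvalRule, leftCode, rightCode, Term.encode] at this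
      obtain ⟨u, h1, w, h2, rfl⟩ := this
      simp only [eval, hs.1 _ _ h1, ht.1 _ _ h2, (decodeTop_monotone M).map_min]
    refine ⟨hval, fun h => ?_⟩
    rcases hC.finRule _ h with h | h
    · exact hfin _ hval h
    · simp [leftCode, rightCode, Term.encode] at h
      exact ((htw s).finitary_inf_iff (htw t)).2 (h.imp hs.2 ht.2)
  | join s t hs ht =>
    have hval : ∀ x y, V (Term.join s t).encode x y →
        eval (fun i => extendSamples M V (Nat.pair 0 i)) (Term.join s t) (decodeTop M x) =
          decodeTop M y := by
      intro x y h
      have := hC.evalRule _ _ _ h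
      simp [EvalRule, leftCode, rightCode, Term.encode] at this
      obtain ⟨u, h1, w, h2, rfl⟩ := this
      simp only [eval, hs.1 _ _ h1, ht.1 _ _ h2, (decodeTop_monotone M).map_max]
    refine ⟨hval, fun h => ?_⟩
    rcases hC.finRule _ h with h | h
    · exact hfin _ hval h
    · simp [leftCode, rightCode, Term.encode] at h
      exact finitary_sup_iff.2 ⟨hs.2 h.1, ht.2 h.2⟩

end IsCertificate

section Rules

variable {α : Type*} [LinearOrder α] [Zero α] [One α] [Add α] {top : α}
  {V V' : ℕ → α → α → Prop} {F F' : ℕ → Prop} {e : ℕ} {x y : α}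

lemma StarRule.mono (hV : ∀ e x y, V e x y → V' e x y) (hF : ∀ e, F e → F' e)
    (h : StarRule top V F e x y) : StarRule top V' F' e x y := by
  rcases h with h | ⟨h, u, w, h1, h2, h3⟩ | ⟨h, u, h1, h2⟩ | ⟨h, h', h1⟩
  · exact Or.inl h
  · exact Or.inr (Or.inl ⟨h, u, w, hV _ _ _ h1, hV _ _ _ h2, h3⟩)
  · exact Or.inr (Or.inr (Or.inl ⟨h, u, hV _ _ _ h1, h2⟩))
  · exact Or.inr (Or.inr (Or.inr ⟨h, h', hF _ h1⟩))

lemma EvalRule.mono (hV : ∀ e x y, V e x y → V' e x y) (hF : ∀ e, F e → F' e)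
    (h : EvalRule top V F e x y) : EvalRule top V' F' e x y := by
  rcases h with h | h | ⟨h, z, h1, h2⟩ | ⟨h, h1, h2⟩ | ⟨h, u, w, h1, h2, h3⟩ |
    ⟨h, u, w, h1, h2, h3⟩
  · exact Or.inl h
  · exact Or.inr (Or.inl h)
  · exact Or.inr (Or.inr (Or.inl ⟨h, z, hV _ _ _ h1, hV _ _ _ h2⟩))
  · exact Or.inr (Or.inr (Or.inr (Or.inl ⟨h, hV _ _ _ h1, h2.mono hV hF⟩)))
  · exact Or.inr (Or.inr (Or.inr (Or.inr (Or.inl ⟨h, u, w, hV _ _ _ h1, hV _ _ _ h2, h3⟩))))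
  · exact Or.inr (Or.inr (Or.inr (Or.inr (Or.inr ⟨h, u, w, hV _ _ _ h1, hV _ _ _ h2, h3⟩))))

end Rules

lemma FinRule.mono {α : Type*} [LinearOrder α] {top : α} {V V' : ℕ → α → α → Prop}
    {F F' : ℕ → Prop} {e : ℕ} (hV : ∀ e x y, V e x y → V' e x y) (hF : ∀ e, F e → F' e)
    (h : FinRule top V F e) : FinRule top V' F' e := by
  rcases h with ⟨u, h1, h2⟩ | h | h | ⟨h, h1, h2⟩ | ⟨h, h1⟩ | ⟨h, h1⟩ | ⟨h, h1, h2⟩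
  · exact Or.inl ⟨u, hV _ _ _ h1, h2⟩
  · exact Or.inr (Or.inl h)
  · exact Or.inr (Or.inr (Or.inl h))
  · exact Or.inr (Or.inr (Or.inr (Or.inl ⟨h, hF _ h1, hF _ h2⟩)))
  · exact Or.inr (Or.inr (Or.inr (Or.inr (Or.inl ⟨h, hV _ _ _ h1⟩))))
  · exact Or.inr (Or.inr (Or.inr (Or.inr (Or.inr (Or.inl ⟨h, h1.imp (hF _) (hF _)⟩)))))
  · exact Or.inr (Or.inr (Or.inr (Or.inr (Or.inr (Or.inr ⟨h, hF _ h1, hF _ h2⟩)))))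

/-! ### Traces of evaluations -/

/-- A finite set of true facts about the assignment `h`, each justified by facts about immediate
subterms, that involves codes up to `B` and at most `n` values. -/
structure IsTrace (h : ℕ → ℕ∞ → ℕ∞) (B n : ℕ) (T : Finset (ℕ × ℕ∞ × ℕ∞)) (U : Set ℕ) :
    Prop where
  evalRule : ∀ e x y, (e, x, y) ∈ T →
    EvalRule ⊤ (fun e x y => (e, x, y) ∈ T) (fun e => e ∈ U) e x y
  finRule : ∀ e ∈ U, FinRule ⊤ (fun e x y => (e, x, y) ∈ T) (fun e => e ∈ U) e
  eval_eq : ∀ e x y, (e, x, y) ∈ T → ∃ t : Term, e = t.encode ∧ eval h t x = y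
  finitary : ∀ e ∈ U, ∃ t : Term, e = t.encode ∧ Finitary (eval h t)
  code_le : ∀ e x y, (e, x, y) ∈ T → e ≤ B
  code_le' : ∀ e ∈ U, e ≤ B
  card_le : T.card ≤ n

namespace IsTrace

variable {h : ℕ → ℕ∞ → ℕ∞} {B B' n n' : ℕ} {T T' : Finset (ℕ × ℕ∞ × ℕ∞)} {U U' : Set ℕ}

lemma empty (h : ℕ → ℕ∞ → ℕ∞) (B : ℕ) : IsTrace h B 0 ∅ ∅ := by
  constructor <;> simp

lemma weaken (hT : IsTrace h B n T U) (hB : B ≤ B') (hn : n ≤ n') : IsTrace h B' n' T U :=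
  { hT with
    code_le := fun e x y he => (hT.code_le e x y he).trans hB
    code_le' := fun e he => (hT.code_le' e he).trans hB
    card_le := hT.card_le.trans hn }

lemma union (hT : IsTrace h B n T U) (hT' : IsTrace h B n' T' U') :
    IsTrace h B (n + n') (T ∪ T') (U ∪ U') where
  evalRule e x y he := by
    rcases Finset.mem_union.1 he with he | he
    · exact (hT.evalRule e x y he).mono (fun _ _ _ => Finset.mem_union_left _)
        (fun _ => Set.mem_union_left _)
    · exact (hT'.evalRule e x y he).mono (fun _ _ _ => Finset.mem_union_right _)
        (fun _ => Set.mem_union_right _)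
  finRule e he := by
    rcases he with he | he
    · exact (hT.finRule e he).mono (fun _ _ _ => Finset.mem_union_left _)
        (fun _ => Set.mem_union_left _)
    · exact (hT'.finRule e he).mono (fun _ _ _ => Finset.mem_union_right _)
        (fun _ => Set.mem_union_right _)
  eval_eq e x y he := (Finset.mem_union.1 he).elim (hT.eval_eq e x y) (hT'.eval_eq e x y)
  finitary e he := he.elim (hT.finitary e) (hT'.finitary e)
  code_le e x y he := (Finset.mem_union.1 he).elim (hT.code_le e x y) (hT'.code_le e x y)
  code_le' e he := he.elim (hT.code_le' e) (hT'.code_le' e)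
  card_le := (Finset.card_union_le T T').trans (add_le_add hT.card_le hT'.card_le)

lemma insert_eval (hT : IsTrace h B n T U) {t : Term} (ht : t.encode ≤ B) {x : ℕ∞}
    (hr : EvalRule ⊤ (fun e x y => (e, x, y) ∈ T) (fun e => e ∈ U) t.encode x (eval h t x)) :
    IsTrace h B (n + 1) (insert (t.encode, x, eval h t x) T) U where
  evalRule e x' y he := by
    refine EvalRule.mono (fun _ _ _ => Finset.mem_insert_of_mem) (fun _ => id) ?_
    rcases Finset.mem_insert.1 he with he | he
    · cases he
      exact hr
    · exact hT.evalRule e x' y he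
  finRule e he := (hT.finRule e he).mono (fun _ _ _ => Finset.mem_insert_of_mem) (fun _ => id)
  eval_eq e x' y he := by
    rcases Finset.mem_insert.1 he with he | he
    · cases he
      exact ⟨t, rfl, rfl⟩
    · exact hT.eval_eq e x' y he
  finitary := hT.finitary
  code_le e x' y he := by
    rcases Finset.mem_insert.1 he with he | he
    · cases he
      exact ht
    · exact hT.code_le e x' y he
  code_le' := hT.code_le'
  card_le := (Finset.card_insert_le _ _).trans (Nat.add_le_add_right hT.card_le 1)

lemma insert_fin (hT : IsTrace h B n T U) {t : Term} (ht : t.encode ≤ B)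
    (hf : Finitary (eval h t))
    (hr : FinRule ⊤ (fun e x y => (e, x, y) ∈ T) (fun e => e ∈ U) t.encode) :
    IsTrace h B n T (insert t.encode U) where
  evalRule e x y he :=
    (hT.evalRule e x y he).mono (fun _ _ _ => id) (fun _ => Set.mem_insert_of_mem _)
  finRule e he := by
    refine FinRule.mono (fun _ _ _ => id) (fun _ => Set.mem_insert_of_mem _) ?_
    rcases he with rfl | he
    · exact hr
    · exact hT.finRule e he
  eval_eq := hT.eval_eq
  finitary e he := by
    rcases he with rfl | he
    · exact ⟨t, rfl, hf⟩
    · exact hT.finitary e he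
  code_le := hT.code_le
  code_le' e he := by
    rcases he with rfl | he
    · exact ht
    · exact hT.code_le' e he
  card_le := hT.card_le

end IsTrace

lemma four_pow_add_lt {a b c : ℕ} (h : a + b < c) : 4 ^ a + 4 ^ b + 1 ≤ 4 ^ c := by
  have h1 : 4 ^ (a + b + 1) ≤ 4 ^ c := Nat.pow_le_pow_right (by norm_num) h
  have h2 : 1 ≤ 4 ^ a := Nat.one_le_pow _ _ (by norm_num)
  have h3 : 1 ≤ 4 ^ b := Nat.one_le_pow _ _ (by norm_num)
  rw [pow_succ, pow_add] at h1
  nlinarith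

lemma three_mul_four_pow_lt {a c : ℕ} (h : a < c) : 4 ^ a + 4 ^ a + 4 ^ a + 1 ≤ 4 ^ c := by
  have h1 : 4 ^ (a + 1) ≤ 4 ^ c := Nat.pow_le_pow_right (by norm_num) h
  have h2 : 1 ≤ 4 ^ a := Nat.one_le_pow _ _ (by norm_num)
  rw [pow_succ] at h1
  omega

lemma add_lt_pair_pair {k : ℕ} (hk : 0 < k) (a b : ℕ) :
    a + b < Nat.pair k (Nat.pair a b) := by
  have h1 := Nat.add_le_pair k (Nat.pair a b)
  have h2 := Nat.add_le_pair a b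
  omega

/-- The bound `4 ^ t.encode` limits the number of values needed to justify a fact about `t`. -/
lemma exists_isTrace {h : ℕ → ℕ∞ → ℕ∞} (hh : ∀ i, IsTimeWarp (h i)) (t : Term) :
    (∀ x, ∃ T U, IsTrace h t.encode (4 ^ t.encode) T U ∧ (t.encode, x, eval h t x) ∈ T) ∧
    (Finitary (eval h t) → ∃ T U, IsTrace h t.encode (4 ^ t.encode) T U ∧ t.encode ∈ U) := by
  have htw := isTimeWarp_eval hh
  have hone : ∀ e : ℕ, 0 + 1 ≤ 4 ^ e := fun e => Nat.one_le_pow _ _ (by norm_num)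
  have hval : ∀ {t : Term} {n T U} {x : ℕ∞}, IsTrace h t.encode n T U → n + 1 ≤ 4 ^ t.encode →
      EvalRule ⊤ (fun e x y => (e, x, y) ∈ T) (fun e => e ∈ U) t.encode x (eval h t x) →
      ∃ T U, IsTrace h t.encode (4 ^ t.encode) T U ∧ (t.encode, x, eval h t x) ∈ T :=
    fun hT hn hr => ⟨_, _, (hT.insert_eval le_rfl hr).weaken le_rfl hn,
      Finset.mem_insert_self _ _⟩
  have hfin : ∀ {t : Term} {n T U}, IsTrace h t.encode n T U → n + 1 ≤ 4 ^ t.encode →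
      Finitary (eval h t) →
      FinRule ⊤ (fun e x y => (e, x, y) ∈ T) (fun e => e ∈ U) t.encode →
      ∃ T U, IsTrace h t.encode (4 ^ t.encode) T U ∧ t.encode ∈ U :=
    fun hT hn hf hr => ⟨_, _, (hT.insert_fin le_rfl hf hr).weaken le_rfl (by omega),
      Set.mem_insert _ _⟩
  have hbdd : ∀ {t : Term}, (∃ T U, IsTrace h t.encode (4 ^ t.encode) T U ∧
      (t.encode, ⊤, eval h t ⊤) ∈ T) → eval h t ⊤ < ⊤ →
      ∃ T U, IsTrace h t.encode (4 ^ t.encode) T U ∧ t.encode ∈ U := by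
    rintro t ⟨T, U, hT, hm⟩ hlt
    exact ⟨_, _, hT.insert_fin le_rfl ((htw t).finitary_of_lt_top hlt)
      (Or.inl ⟨_, hm, hlt⟩), Set.mem_insert _ _⟩
  induction t with
  | var i =>
    exact ⟨fun x => hval (IsTrace.empty h _) (hone _) (Or.inl (by simp [Term.encode])),
      fun hf => hfin (IsTrace.empty h _) (hone _) hf (Or.inr (Or.inl (by simp [Term.encode])))⟩
  | one =>
    exact ⟨fun x => hval (IsTrace.empty h _) (hone _)
        (Or.inr (Or.inl (by simp [Term.encode, eval]))),
      fun hf => hfin (IsTrace.empty h _) (hone _) hf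
        (Or.inr (Or.inr (Or.inl (by simp [Term.encode]))))⟩
  | mul s t hs ht =>
    have hlt : s.encode + t.encode < (Term.mul s t).encode := add_lt_pair_pair (by norm_num) _ _
    have hle : s.encode ≤ (Term.mul s t).encode := by omega
    have hle' : t.encode ≤ (Term.mul s t).encode := by omega
    have hv : ∀ x, ∃ T U, IsTrace h (Term.mul s t).encode (4 ^ (Term.mul s t).encode) T U ∧
        ((Term.mul s t).encode, x, eval h (Term.mul s t) x) ∈ T := by
      intro x
      obtain ⟨T, U, hT, hm⟩ := ht.1 x
      obtain ⟨T', U', hT', hm'⟩ := hs.1 (eval h t x)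
      refine hval ((hT'.weaken hle le_rfl).union (hT.weaken hle' le_rfl)) (four_pow_add_lt hlt)
        (Or.inr (Or.inr (Or.inl ⟨by simp [Term.encode], eval h t x, ?_, ?_⟩)))
      · simp [rightCode, Term.encode, hm]
      · simp [leftCode, Term.encode, eval, hm']
    refine ⟨hv, fun hf => ?_⟩
    rcases ((htw s).finitary_comp_iff (htw t)).1 hf with h' | ⟨h1, h2⟩
    · exact hbdd (hv ⊤) h'
    · obtain ⟨T, U, hT, hm⟩ := ht.2 h2
      obtain ⟨T', U', hT', hm'⟩ := hs.2 h1
      exact hfin ((hT'.weaken hle le_rfl).union (hT.weaken hle' le_rfl)) (four_pow_add_lt hlt) hf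
        (Or.inr (Or.inr (Or.inr (Or.inl (by simp [leftCode, rightCode, Term.encode, hm, hm'])))))
  | star s hs =>
    have hlt : s.encode < (Term.star s).encode := by
      have := Nat.add_le_pair 3 s.encode
      rw [Term.encode]
      omega
    have hpow := three_mul_four_pow_lt hlt
    have hpos := hone s.encode
    refine ⟨fun x => ?_, fun hf => ?_⟩
    · obtain ⟨T, U, hT, hm⟩ := hs.1 0
      rw [(htw s).zero] at hm
      have hT := hT.weaken hlt.le le_rfl
      have hrule : ∀ {T' : Finset (ℕ × ℕ∞ × ℕ∞)} {U' : Set ℕ}, T ⊆ T' →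
          StarRule ⊤ (fun e x y => (e, x, y) ∈ T') (fun e => e ∈ U') s.encode x
            (eval h (Term.star s) x) →
          EvalRule ⊤ (fun e x y => (e, x, y) ∈ T') (fun e => e ∈ U') (Term.star s).encode x
            (eval h (Term.star s) x) := fun hsub hr =>
        Or.inr (Or.inr (Or.inr (Or.inl ⟨by simp [Term.encode], by
          simpa [Term.encode] using hsub hm, by simpa [Term.encode] using hr⟩)))
      rcases (htw s).winv_cases x with rfl | ⟨n, h1, h2⟩ | h1 | ⟨rfl, h1⟩
      · exact hval hT (by omega) (hrule subset_rfl (Or.inl ⟨rfl, winv_zero _⟩))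
      · have hw : eval h (Term.star s) x = n := winv_eq_natCast (htw s).mono h1 h2
        obtain ⟨T', U', hT', hm'⟩ := hs.1 n
        obtain ⟨T'', U'', hT'', hm''⟩ := hs.1 (n + 1)
        refine hval ((hT.union (hT'.weaken hlt.le le_rfl)).union (hT''.weaken hlt.le le_rfl)) hpow
          (hrule (by grind) (Or.inr (Or.inl ⟨?_, _, _, ?_, ?_, h1, h2⟩)))
        · rw [hw]
          exact ENat.natCast_lt_top (n + 1)
        · simp [hw, hm']
        · simp [hw, hm'']
      · have hw : eval h (Term.star s) x = ⊤ := winv_eq_top (htw s).mono h1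
        obtain ⟨T', U', hT', hm'⟩ := hs.1 ⊤
        exact hval (hT.union (hT'.weaken hlt.le le_rfl)) (by omega)
          (hrule (by grind) (Or.inr (Or.inr (Or.inl ⟨hw, _, by simp [hm'], h1⟩))))
      · have hw : eval h (Term.star s) ⊤ = ⊤ := winv_top_of_finitary h1
        obtain ⟨T', U', hT', hm'⟩ := hs.2 h1
        exact hval (hT.union (hT'.weaken hlt.le le_rfl)) (by omega)
          (hrule (by grind) (Or.inr (Or.inr (Or.inr ⟨rfl, hw, by simp [hm']⟩))))
    · obtain ⟨T, U, hT, hm⟩ := hs.1 ⊤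
      rw [(htw s).finitary_winv_iff.1 hf] at hm
      exact hfin (hT.weaken hlt.le le_rfl) (by omega) hf
        (Or.inr (Or.inr (Or.inr (Or.inr (Or.inl (by simp [Term.encode, hm]))))))
  | meet s t hs ht =>
    have hlt : s.encode + t.encode < (Term.meet s t).encode := add_lt_pair_pair (by norm_num) _ _
    have hle : s.encode ≤ (Term.meet s t).encode := by omega
    have hle' : t.encode ≤ (Term.meet s t).encode := by omega
    have hpow := four_pow_add_lt hlt
    have hpos := hone s.encode
    have hpos' := hone t.encode
    refine ⟨fun x => ?_, fun hf => ?_⟩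
    · obtain ⟨T, U, hT, hm⟩ := hs.1 x
      obtain ⟨T', U', hT', hm'⟩ := ht.1 x
      refine hval ((hT.weaken hle le_rfl).union (hT'.weaken hle' le_rfl)) hpow
        (Or.inr (Or.inr (Or.inr (Or.inr (Or.inl ⟨by simp [Term.encode], _, _, ?_, ?_, rfl⟩)))))
      · simp [leftCode, Term.encode, hm]
      · simp [rightCode, Term.encode, hm']
    · rcases ((htw s).finitary_inf_iff (htw t)).1 hf with h1 | h1
      · obtain ⟨T, U, hT, hm⟩ := hs.2 h1
        exact hfin (hT.weaken hle le_rfl) (by omega) hf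
          (Or.inr (Or.inr (Or.inr (Or.inr (Or.inr (Or.inl (by
            simp [leftCode, rightCode, Term.encode, hm])))))))
      · obtain ⟨T, U, hT, hm⟩ := ht.2 h1
        exact hfin (hT.weaken hle' le_rfl) (by omega) hf
          (Or.inr (Or.inr (Or.inr (Or.inr (Or.inr (Or.inl (by
            simp [leftCode, rightCode, Term.encode, hm])))))))
  | join s t hs ht =>
    have hlt : s.encode + t.encode < (Term.join s t).encode := add_lt_pair_pair (by norm_num) _ _
    have hle : s.encode ≤ (Term.join s t).encode := by omega
    have hle' : t.encode ≤ (Term.join s t).encode := by omega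
    have hpow := four_pow_add_lt hlt
    refine ⟨fun x => ?_, fun hf => ?_⟩
    · obtain ⟨T, U, hT, hm⟩ := hs.1 x
      obtain ⟨T', U', hT', hm'⟩ := ht.1 x
      refine hval ((hT.weaken hle le_rfl).union (hT'.weaken hle' le_rfl)) hpow
        (Or.inr (Or.inr (Or.inr (Or.inr (Or.inr ⟨by simp [Term.encode], _, _, ?_, ?_, rfl⟩)))))
      · simp [leftCode, Term.encode, hm]
      · simp [rightCode, Term.encode, hm']
    · obtain ⟨h1, h2⟩ := finitary_sup_iff.1 hf
      obtain ⟨T, U, hT, hm⟩ := hs.2 h1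
      obtain ⟨T', U', hT', hm'⟩ := ht.2 h2
      exact hfin ((hT.weaken hle le_rfl).union (hT'.weaken hle' le_rfl)) hpow hf
        (Or.inr (Or.inr (Or.inr (Or.inr (Or.inr (Or.inr (by
          simp [leftCode, rightCode, Term.encode, hm, hm'])))))))

/-! ### From traces to certificates -/

/-- The number of elements of `P` strictly below `x`. -/
def rankIn (P : Finset ℕ∞) (x : ℕ∞) : ℕ := (P.filter (· < x)).card

lemma rankIn_mono (P : Finset ℕ∞) : Monotone (rankIn P) := fun _ _ h =>
  Finset.card_le_card (Finset.monotone_filter_right P fun _ _ h' => lt_of_lt_of_le h' h)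

lemma rankIn_lt {P : Finset ℕ∞} {x y : ℕ∞} (hx : x ∈ P) (h : x < y) :
    rankIn P x < rankIn P y := by
  refine Finset.card_lt_card (Finset.ssubset_iff_of_subset ?_ |>.2 ⟨x, ?_, ?_⟩)
  · exact Finset.monotone_filter_right P fun _ _ h' => lt_trans h' h
  · exact Finset.mem_filter.2 ⟨hx, h⟩
  · simp

lemma rankIn_zero (P : Finset ℕ∞) : rankIn P 0 = 0 := by
  simp [rankIn]

lemma rankIn_succ {P : Finset ℕ∞} {x : ℕ∞} (hx : x ∈ P) (h : x < ⊤) :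
    rankIn P (x + 1) = rankIn P x + 1 := by
  have : P.filter (· < x + 1) = insert x (P.filter (· < x)) := by
    ext y
    simp only [Finset.mem_filter, Finset.mem_insert, ENat.lt_add_one_iff h.ne]
    constructor
    · rintro ⟨hy, hyx⟩
      exact hyx.eq_or_lt.imp id fun h' => ⟨hy, h'⟩
    · rintro (rfl | ⟨hy, hyx⟩)
      · exact ⟨hx, le_rfl⟩
      · exact ⟨hy, hyx.le⟩
  rw [rankIn, this, Finset.card_insert_of_notMem (by simp), rankIn]

lemma lt_of_rankIn_lt {P : Finset ℕ∞} {x y : ℕ∞} (h : rankIn P x < rankIn P y) : x < y :=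
  (rankIn_mono P).reflect_lt h

lemma le_of_rankIn_le {P : Finset ℕ∞} {x y : ℕ∞} (hy : y ∈ P) (h : rankIn P x ≤ rankIn P y) :
    x ≤ y :=
  not_lt.1 fun h' => absurd (rankIn_lt hy h') (not_lt_of_ge h)

/-- Facts about `ℕ∞` renamed along `rankIn P`. -/
def rankFacts (P : Finset ℕ∞) (T : Finset (ℕ × ℕ∞ × ℕ∞)) (e a b : ℕ) : Prop :=
  ∃ x y, (e, x, y) ∈ T ∧ rankIn P x = a ∧ rankIn P y = b

section Rank

variable {P : Finset ℕ∞} {T : Finset (ℕ × ℕ∞ × ℕ∞)} {F : ℕ → Prop} {e : ℕ} {x y : ℕ∞}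

lemma rankFacts_of_mem (h : (e, x, y) ∈ T) : rankFacts P T e (rankIn P x) (rankIn P y) :=
  ⟨x, y, h, rfl, rfl⟩

lemma StarRule.rank (hP : ∀ e x y, (e, x, y) ∈ T → x ∈ P ∧ y ∈ P)
    (h : StarRule ⊤ (fun e x y => (e, x, y) ∈ T) F e x y) :
    StarRule (rankIn P ⊤) (rankFacts P T) F e (rankIn P x) (rankIn P y) := by
  rcases h with ⟨rfl, rfl⟩ | ⟨h, u, w, h1, h2, h3, h4⟩ | ⟨rfl, u, h1, h2⟩ | ⟨rfl, rfl, h1⟩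
  · exact Or.inl ⟨rankIn_zero P, rankIn_zero P⟩
  · have hs := rankIn_succ (hP _ _ _ h1).1 (lt_of_le_of_lt le_self_add h)
    refine Or.inr (Or.inl ⟨?_, rankIn P u, rankIn P w, rankFacts_of_mem h1, ?_,
      rankIn_lt (hP _ _ _ h1).2 h3, rankIn_mono P h4⟩)
    · rw [← hs]
      exact rankIn_lt (hP _ _ _ h2).1 h
    · rw [← hs]
      exact rankFacts_of_mem h2
  · exact Or.inr (Or.inr (Or.inl ⟨rfl, rankIn P u, rankFacts_of_mem h1,
      rankIn_lt (hP _ _ _ h1).2 h2⟩))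
  · exact Or.inr (Or.inr (Or.inr ⟨rfl, rfl, h1⟩))

lemma EvalRule.rank (hP : ∀ e x y, (e, x, y) ∈ T → x ∈ P ∧ y ∈ P)
    (h : EvalRule ⊤ (fun e x y => (e, x, y) ∈ T) F e x y) :
    EvalRule (rankIn P ⊤) (rankFacts P T) F e (rankIn P x) (rankIn P y) := by
  rcases h with h | ⟨h, h', rfl⟩ | ⟨h, z, h1, h2⟩ | ⟨h, h1, h2⟩ | ⟨h, u, w, h1, h2, rfl⟩ |
    ⟨h, u, w, h1, h2, rfl⟩
  · exact Or.inl h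
  · exact Or.inr (Or.inl ⟨h, h', rfl⟩)
  · exact Or.inr (Or.inr (Or.inl ⟨h, _, rankFacts_of_mem h1, rankFacts_of_mem h2⟩))
  · refine Or.inr (Or.inr (Or.inr (Or.inl ⟨h, ?_, h2.rank hP⟩)))
    have := rankFacts_of_mem (P := P) h1
    rwa [rankIn_zero] at this
  · exact Or.inr (Or.inr (Or.inr (Or.inr (Or.inl ⟨h, _, _, rankFacts_of_mem h1,
      rankFacts_of_mem h2, (rankIn_mono P).map_min⟩))))
  · exact Or.inr (Or.inr (Or.inr (Or.inr (Or.inr ⟨h, _, _, rankFacts_of_mem h1,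
      rankFacts_of_mem h2, (rankIn_mono P).map_max⟩))))

lemma FinRule.rank (hP : ∀ e x y, (e, x, y) ∈ T → x ∈ P ∧ y ∈ P)
    (h : FinRule ⊤ (fun e x y => (e, x, y) ∈ T) F e) :
    FinRule (rankIn P ⊤) (rankFacts P T) F e := by
  rcases h with ⟨u, h1, h2⟩ | h | h | h | ⟨h, h1⟩ | h
  · exact Or.inl ⟨_, rankFacts_of_mem h1, rankIn_lt (hP _ _ _ h1).2 h2⟩
  · exact Or.inr (Or.inl h)
  · exact Or.inr (Or.inr (Or.inl h))
  · exact Or.inr (Or.inr (Or.inr (Or.inl h)))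
  · exact Or.inr (Or.inr (Or.inr (Or.inr (Or.inl ⟨h, rankFacts_of_mem h1⟩))))
  · exact Or.inr (Or.inr (Or.inr (Or.inr (Or.inr h))))

end Rank

lemma Term.eq_var_of_unpair {t : Term} (h : t.encode.unpair.1 = 0) : ∃ i, t = Term.var i := by
  cases t with
  | var i => exact ⟨i, rfl⟩
  | _ => simp [Term.encode] at h

lemma IsTrace.isCertificate {h : ℕ → ℕ∞ → ℕ∞} (hh : ∀ i, IsTimeWarp (h i)) {B n : ℕ}
    {T : Finset (ℕ × ℕ∞ × ℕ∞)} {U : Set ℕ} (hT : IsTrace h B n T U) {P : Finset ℕ∞}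
    (h0 : 0 ∈ P) (hP : ∀ e x y, (e, x, y) ∈ T → x ∈ P ∧ y ∈ P) :
    IsCertificate (rankIn P ⊤) (rankFacts P T) (fun e => e ∈ U) where
  top_pos := (Nat.zero_le _).trans_lt (rankIn_lt h0 ENat.top_pos)
  le_top := by
    rintro e _ _ ⟨x, y, -, rfl, rfl⟩
    exact ⟨rankIn_mono P le_top, rankIn_mono P le_top⟩
  evalRule := by
    rintro e _ _ ⟨x, y, he, rfl, rfl⟩
    exact (hT.evalRule e x y he).rank hP
  finRule e he := (hT.finRule e he).rank hP
  var_mono := by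
    rintro e _ _ _ _ ⟨x, y, he, rfl, rfl⟩ ⟨x', y', he', rfl, rfl⟩ hv hle
    have hxx' := le_of_rankIn_le (hP _ _ _ he').1 hle
    obtain ⟨t, rfl, rfl⟩ := hT.eval_eq _ _ _ he
    obtain ⟨t', ht', rfl⟩ := hT.eval_eq _ _ _ he'
    obtain ⟨i, rfl⟩ := Term.eq_var_of_unpair hv
    rw [ht'] at hv
    obtain ⟨j, rfl⟩ := Term.eq_var_of_unpair hv
    simp only [Term.encode, Nat.pair_eq_pair, true_and] at ht'
    subst ht'
    exact rankIn_mono P ((hh i).mono hxx')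
  var_zero := by
    rintro e _ ⟨x, y, he, hx, rfl⟩ hv
    have hx0 : x = 0 := by
      refine le_antisymm (le_of_rankIn_le h0 ?_) zero_le
      rw [hx]
      exact Nat.zero_le _
    subst hx0
    obtain ⟨t, rfl, rfl⟩ := hT.eval_eq _ _ _ he
    rw [(isTimeWarp_eval hh t).zero, rankIn_zero]
  var_fin := by
    rintro e _ _ ⟨x, y, he, rfl, rfl⟩ hU hv hlt
    obtain ⟨t, rfl, rfl⟩ := hT.eval_eq _ _ _ he
    obtain ⟨t', ht', hf⟩ := hT.finitary _ hU
    obtain ⟨i, rfl⟩ := Term.eq_var_of_unpair hv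
    rw [ht'] at hv
    obtain ⟨j, rfl⟩ := Term.eq_var_of_unpair hv
    simp only [Term.encode, Nat.pair_eq_pair, true_and] at ht'
    subst ht'
    obtain ⟨k, rfl⟩ := ENat.ne_top_iff_exists.1 (lt_of_rankIn_lt hlt).ne
    exact rankIn_lt (hP _ _ _ he).2 (hf k)

/-- A trace can be renamed to a certificate of bounded size, injectively on its values. -/
lemma IsTrace.exists_isCertificate {h : ℕ → ℕ∞ → ℕ∞} (hh : ∀ i, IsTimeWarp (h i)) {B n : ℕ}
    {T : Finset (ℕ × ℕ∞ × ℕ∞)} {U : Set ℕ} (hT : IsTrace h B n T U) :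
    ∃ M V F, IsCertificate M V F ∧ M ≤ 2 * n + 1 ∧ (∀ e x y, V e x y → e ≤ B) ∧
      (∀ e, F e → e ≤ B) ∧ ∃ c : ℕ∞ → ℕ, (∀ e x y, (e, x, y) ∈ T → V e (c x) (c y)) ∧
      ∀ e x y e' x' y', (e, x, y) ∈ T → (e', x', y') ∈ T → c y = c y' → y = y' := by
  classical
  obtain ⟨P, hPdef⟩ : ∃ P : Finset ℕ∞,
      P = insert 0 (T.image (fun p => p.2.1) ∪ T.image (fun p => p.2.2)) := ⟨_, rfl⟩
  have hP : ∀ e x y, (e, x, y) ∈ T → x ∈ P ∧ y ∈ P := by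
    intro e x y he
    rw [hPdef]
    exact ⟨Finset.mem_insert_of_mem (Finset.mem_union_left _ (Finset.mem_image_of_mem _ he)),
      Finset.mem_insert_of_mem (Finset.mem_union_right _ (Finset.mem_image_of_mem _ he))⟩
  refine ⟨_, _, _, hT.isCertificate hh (hPdef ▸ Finset.mem_insert_self _ _) hP, ?_, ?_, hT.code_le',
    rankIn P, fun e x y => rankFacts_of_mem, ?_⟩
  · have h1 : rankIn P ⊤ ≤ P.card := Finset.card_filter_le _ _
    have h2 := Finset.card_insert_le (0 : ℕ∞)
      (T.image (fun p => p.2.1) ∪ T.image (fun p => p.2.2))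
    rw [← hPdef] at h2
    have h3 := Finset.card_union_le (T.image (fun p => p.2.1)) (T.image (fun p => p.2.2))
    have h4 := Finset.card_image_le (s := T) (f := fun p => p.2.1)
    have h5 := Finset.card_image_le (s := T) (f := fun p => p.2.2)
    have h6 := hT.card_le
    omega
  · rintro e _ _ ⟨x, y, he, -, -⟩
    exact hT.code_le e x y he
  · intro e x y e' x' y' he he' hc
    exact le_antisymm (le_of_rankIn_le (hP _ _ _ he').2 hc.le)
      (le_of_rankIn_le (hP _ _ _ he).2 hc.ge)

/-! ### The decision procedure -/

/-- The binary digit of `g` at position `i` is one. -/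
def bitSet (g i : ℕ) : Prop := g / 2 ^ i % 2 = 1

lemma exists_bitSet_iff (K : ℕ) (p : ℕ → Prop) : ∃ g < 2 ^ K, ∀ i < K, bitSet g i ↔ p i := by
  classical
  refine ⟨Nat.ofBits fun i : Fin K => decide (p i), Nat.ofBits_lt_two_pow _, fun i hi => ?_⟩
  have := Nat.testBit_ofBits_lt (fun i : Fin K => decide (p i)) i hi
  rw [Nat.testBit_eq_decide_div_mod_eq] at this
  rw [bitSet]
  simpa using this

/-- The value facts coded by the digits of `c.2.2.1`, restricted to numbers below `c.1`. -/
def codedEval (c : ℕ × ℕ × ℕ × ℕ) (e x y : ℕ) : Prop :=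
  (e < c.1 ∧ x < c.1 ∧ y < c.1) ∧ bitSet c.2.2.1 (Nat.pair e (Nat.pair x y))

/-- The finitarity facts coded by the digits of `c.2.2.2`, restricted to numbers below `c.1`. -/
def codedFin (c : ℕ × ℕ × ℕ × ℕ) (e : ℕ) : Prop :=
  e < c.1 ∧ bitSet c.2.2.2 e

/-- The tuple `c` codes a certificate with top element `c.2.1`. -/
def CodesCertificate (c : ℕ × ℕ × ℕ × ℕ) : Prop :=
  IsCertificate c.2.1 (codedEval c) (codedFin c)

/-- Facts about numbers below `N` can be coded by the digits of bounded numbers. -/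
lemma exists_coded {N : ℕ} {V : ℕ → ℕ → ℕ → Prop} {F : ℕ → Prop}
    (hV : ∀ e x y, V e x y → e < N ∧ x < N ∧ y < N) (hF : ∀ e, F e → e < N) (M : ℕ) :
    ∃ g < 2 ^ Nat.pair N (Nat.pair N N), ∃ k < 2 ^ N,
      codedEval (N, M, g, k) = V ∧ codedFin (N, M, g, k) = F := by
  obtain ⟨g, hg, hg'⟩ := exists_bitSet_iff (Nat.pair N (Nat.pair N N))
    fun i => V i.unpair.1 i.unpair.2.unpair.1 i.unpair.2.unpair.2
  obtain ⟨k, hk, hk'⟩ := exists_bitSet_iff N F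
  refine ⟨g, hg, k, hk, ?_, ?_⟩
  · funext e x y
    refine propext ⟨fun ⟨⟨he, hx, hy⟩, h⟩ => ?_, fun h => ?_⟩
    · have hlt : Nat.pair e (Nat.pair x y) < Nat.pair N (Nat.pair N N) :=
        (Nat.pair_lt_pair_left _ he).trans (Nat.pair_lt_pair_right _
          ((Nat.pair_lt_pair_left _ hx).trans (Nat.pair_lt_pair_right _ hy)))
      simpa using (hg' _ hlt).1 h
    · obtain ⟨he, hx, hy⟩ := hV e x y h
      have hlt : Nat.pair e (Nat.pair x y) < Nat.pair N (Nat.pair N N) :=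
        (Nat.pair_lt_pair_left _ he).trans (Nat.pair_lt_pair_right _
          ((Nat.pair_lt_pair_left _ hx).trans (Nat.pair_lt_pair_right _ hy)))
      exact ⟨⟨he, hx, hy⟩, (hg' _ hlt).2 (by simpa using h)⟩
  · funext e
    exact propext ⟨fun ⟨he, h⟩ => (hk' e he).1 h, fun h => ⟨hF e h, (hk' e (hF e h)).2 h⟩⟩

section Primrec

open Primrec

variable {β : Type*} [Primcodable β]

lemma primrec_pow {f g : β → ℕ} (hf : Primrec f) (hg : Primrec g) :
    Primrec fun b => f b ^ g b := by
  have h : Primrec fun b => Nat.rec (motive := fun _ => ℕ) 1 (fun _ r => r * f b) (g b) :=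
    nat_rec' hg (const 1) (nat_mul.comp (snd.comp snd) (hf.comp fst)).to₂
  refine h.of_eq fun b => ?_
  induction g b with
  | zero => rfl
  | succ n ih => rw [pow_succ, ← ih]

lemma primrecPred_exists_lt {n : β → ℕ} {p : β → ℕ → Prop} (hn : Primrec n)
    (hp : PrimrecPred fun q : β × ℕ => p q.1 q.2) : PrimrecPred fun b => ∃ x < n b, p b x := by
  have h : PrimrecRel fun (x : ℕ) (b : β) => p b x := hp.comp (snd.pair fst)
  exact (h.exists_mem_list.comp (list_range.comp hn) Primrec.id).of_eq fun b => by simp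

lemma primrecPred_exists {n : β → ℕ} {p : β → ℕ → Prop} (hn : Primrec n)
    (hp : PrimrecPred fun q : β × ℕ => p q.1 q.2) (hb : ∀ b x, p b x → x < n b) :
    PrimrecPred fun b => ∃ x, p b x :=
  (primrecPred_exists_lt hn hp).of_eq fun b =>
    ⟨fun ⟨x, _, h⟩ => ⟨x, h⟩, fun ⟨x, h⟩ => ⟨x, hb b x h, h⟩⟩

lemma primrecPred_forall {n : β → ℕ} {p : β → ℕ → Prop} (hn : Primrec n)
    (hp : PrimrecPred fun q : β × ℕ => p q.1 q.2) (hb : ∀ b x, n b ≤ x → p b x) :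
    PrimrecPred fun b => ∀ x, p b x :=
  (primrecPred_exists hn hp.not fun b x h => not_le.1 fun h' => h (hb b x h')).not.of_eq
    fun _ => not_exists_not

lemma primrecPred_imp {p q : β → Prop} (hp : PrimrecPred p) (hq : PrimrecPred q) :
    PrimrecPred fun b => p b → q b :=
  (hp.not.or hq).of_eq fun _ => imp_iff_not_or.symm

lemma primrecPred_bitSet {f g : β → ℕ} (hf : Primrec f) (hg : Primrec g) :
    PrimrecPred fun b => bitSet (f b) (g b) :=
  Primrec.eq.comp (nat_mod.comp (nat_div.comp hf (primrec_pow (const 2) hg)) (const 2)) (const 1)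

variable {c : β → ℕ × ℕ × ℕ × ℕ} {e x y : β → ℕ}

lemma primrecPred_codedEval (hc : Primrec c) (he : Primrec e) (hx : Primrec x) (hy : Primrec y) :
    PrimrecPred fun b => codedEval (c b) (e b) (x b) (y b) := by
  have hN : Primrec fun b => (c b).1 := fst.comp hc
  exact ((nat_lt.comp he hN).and ((nat_lt.comp hx hN).and (nat_lt.comp hy hN))).and
    (primrecPred_bitSet (fst.comp (snd.comp (snd.comp hc)))
      (Primrec₂.natPair.comp he (Primrec₂.natPair.comp hx hy)))

lemma primrecPred_codedFin (hc : Primrec c) (he : Primrec e) :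
    PrimrecPred fun b => codedFin (c b) (e b) :=
  (nat_lt.comp he (fst.comp hc)).and
    (primrecPred_bitSet (snd.comp (snd.comp (snd.comp hc))) he)

lemma primrec_top (hc : Primrec c) : Primrec fun b => (c b).2.1 := fst.comp (snd.comp hc)

lemma primrecPred_starRule (hc : Primrec c) (he : Primrec e) (hx : Primrec x) (hy : Primrec y) :
    PrimrecPred fun b =>
      StarRule (c b).2.1 (codedEval (c b)) (codedFin (c b)) (e b) (x b) (y b) := by
  have hN : Primrec fun b => (c b).1 := fst.comp hc
  have hM := primrec_top hc
  refine PrimrecPred.or ((Primrec.eq.comp hx (const 0)).and (Primrec.eq.comp hy (const 0)))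
    (PrimrecPred.or (PrimrecPred.and (nat_lt.comp (succ.comp hy) hM) ?_)
      (PrimrecPred.or (PrimrecPred.and (Primrec.eq.comp hy hM) ?_)
        ((Primrec.eq.comp hx hM).and ((Primrec.eq.comp hy hM).and
          (primrecPred_codedFin hc he)))))
  · refine primrecPred_exists hN ?_ fun b u ⟨_, h, _⟩ => h.1.2.2
    refine primrecPred_exists (hN.comp fst) ?_ fun b u h => h.2.1.1.2.2
    have hl : Primrec fun q : (β × ℕ) × ℕ => q.1.1 := fst.comp fst
    have hu : Primrec fun q : (β × ℕ) × ℕ => q.1.2 := snd.comp fst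
    exact (primrecPred_codedEval (hc.comp hl) (he.comp hl) (hy.comp hl) hu).and
      ((primrecPred_codedEval (hc.comp hl) (he.comp hl) (succ.comp (hy.comp hl)) snd).and
        ((nat_lt.comp hu (hx.comp hl)).and (nat_le.comp (hx.comp hl) snd)))
  · refine primrecPred_exists hN ?_ fun b u h => h.1.1.2.2
    exact (primrecPred_codedEval (hc.comp fst) (he.comp fst) (hM.comp fst) snd).and
      (nat_lt.comp snd (hx.comp fst))

lemma primrec_tag (he : Primrec e) : Primrec fun b => (e b).unpair.1 :=
  fst.comp (unpair.comp he)

lemma primrec_arg (he : Primrec e) : Primrec fun b => (e b).unpair.2 :=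
  snd.comp (unpair.comp he)

lemma primrec_leftCode (he : Primrec e) : Primrec fun b => leftCode (e b) :=
  primrec_tag (primrec_arg he)

lemma primrec_rightCode (he : Primrec e) : Primrec fun b => rightCode (e b) :=
  primrec_arg (primrec_arg he)

lemma primrecPred_tag_eq (he : Primrec e) (k : ℕ) : PrimrecPred fun b => (e b).unpair.1 = k :=
  Primrec.eq.comp (primrec_tag he) (const k)

lemma primrecPred_exists_binop (hc : Primrec c) (he : Primrec e) (hx : Primrec x)
    (hy : Primrec y) {op : ℕ → ℕ → ℕ} (hop : Primrec₂ op) :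
    PrimrecPred fun b => ∃ u w, codedEval (c b) (leftCode (e b)) (x b) u ∧
      codedEval (c b) (rightCode (e b)) (x b) w ∧ y b = op u w := by
  have hN : Primrec fun b => (c b).1 := fst.comp hc
  refine primrecPred_exists hN ?_ fun b u ⟨_, h, _⟩ => h.1.2.2
  refine primrecPred_exists (hN.comp fst) ?_ fun b u h => h.2.1.1.2.2
  have hl : Primrec fun q : (β × ℕ) × ℕ => q.1.1 := fst.comp fst
  have hu : Primrec fun q : (β × ℕ) × ℕ => q.1.2 := snd.comp fst
  exact (primrecPred_codedEval (hc.comp hl) ((primrec_leftCode he).comp hl) (hx.comp hl) hu).and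
    ((primrecPred_codedEval (hc.comp hl) ((primrec_rightCode he).comp hl) (hx.comp hl) snd).and
      (Primrec.eq.comp (hy.comp hl) (hop.comp hu snd)))

lemma primrecPred_evalRule (hc : Primrec c) (he : Primrec e) (hx : Primrec x) (hy : Primrec y) :
    PrimrecPred fun b =>
      EvalRule (c b).2.1 (codedEval (c b)) (codedFin (c b)) (e b) (x b) (y b) := by
  refine (primrecPred_tag_eq he 0).or (PrimrecPred.or ?_ (PrimrecPred.or ?_ (PrimrecPred.or ?_
    (PrimrecPred.or ?_ ?_))))
  · exact (primrecPred_tag_eq he 1).and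
      ((Primrec.eq.comp (primrec_arg he) (const 0)).and (Primrec.eq.comp hy hx))
  · refine (primrecPred_tag_eq he 2).and
      (primrecPred_exists (fst.comp hc) ?_ fun b u h => h.1.1.2.2)
    exact (primrecPred_codedEval (hc.comp fst) ((primrec_rightCode he).comp fst)
      (hx.comp fst) snd).and (primrecPred_codedEval (hc.comp fst) ((primrec_leftCode he).comp fst)
        snd (hy.comp fst))
  · exact (primrecPred_tag_eq he 3).and
      ((primrecPred_codedEval hc (primrec_arg he) (const 0) (const 0)).and
        (primrecPred_starRule hc (primrec_arg he) hx hy))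
  · exact (primrecPred_tag_eq he 4).and (primrecPred_exists_binop hc he hx hy nat_min)
  · exact (primrecPred_tag_eq he 5).and (primrecPred_exists_binop hc he hx hy nat_max)

lemma primrecPred_finRule (hc : Primrec c) (he : Primrec e) :
    PrimrecPred fun b => FinRule (c b).2.1 (codedEval (c b)) (codedFin (c b)) (e b) := by
  have hl := primrecPred_codedFin hc (primrec_leftCode he)
  have hr := primrecPred_codedFin hc (primrec_rightCode he)
  have hM := primrec_top hc
  refine PrimrecPred.or (primrecPred_exists (fst.comp hc) ?_ fun b u h => h.1.1.2.2)
    ((primrecPred_tag_eq he 0).or ((primrecPred_tag_eq he 1).or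
      (((primrecPred_tag_eq he 2).and (hl.and hr)).or
        (((primrecPred_tag_eq he 3).and (primrecPred_codedEval hc (primrec_arg he) hM hM)).or
          (((primrecPred_tag_eq he 4).and (hl.or hr)).or
            ((primrecPred_tag_eq he 5).and (hl.and hr)))))))
  exact (primrecPred_codedEval (hc.comp fst) (he.comp fst) (hM.comp fst) snd).and
    (nat_lt.comp snd (hM.comp fst))

lemma primrecPred_forall_codedEval {R : β → ℕ → ℕ → ℕ → Prop} (hc : Primrec c)
    (hR : PrimrecPred fun q : ((β × ℕ) × ℕ) × ℕ => R q.1.1.1 q.1.1.2 q.1.2 q.2) :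
    PrimrecPred fun b => ∀ e x y, codedEval (c b) e x y → R b e x y := by
  have hN : Primrec fun b => (c b).1 := fst.comp hc
  refine primrecPred_forall hN ?_ fun b e h x y h' => absurd h'.1.1 (not_lt_of_ge h)
  refine primrecPred_forall (hN.comp fst) ?_ fun b x h y h' => absurd h'.1.2.1 (not_lt_of_ge h)
  refine primrecPred_forall (hN.comp (fst.comp fst)) ?_
    fun b y h h' => absurd h'.1.2.2 (not_lt_of_ge h)
  exact primrecPred_imp (primrecPred_codedEval (hc.comp (fst.comp (fst.comp fst)))
    (snd.comp (fst.comp fst)) (snd.comp fst) snd) hR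

lemma primrecPred_codesCertificate : PrimrecPred CodesCertificate := by
  let γ := (((ℕ × ℕ × ℕ × ℕ) × ℕ) × ℕ) × ℕ
  have hc : Primrec fun c : ℕ × ℕ × ℕ × ℕ => c := .id
  have hc3 : Primrec fun q : γ => q.1.1.1 := fst.comp (fst.comp fst)
  have he3 : Primrec fun q : γ => q.1.1.2 := snd.comp (fst.comp fst)
  have hx3 : Primrec fun q : γ => q.1.2 := snd.comp fst
  have hy3 : Primrec fun q : γ => q.2 := snd
  have hM3 := primrec_top hc3
  have hvar3 := primrecPred_tag_eq he3 0
  have h1 : PrimrecPred fun c : ℕ × ℕ × ℕ × ℕ => 0 < c.2.1 :=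
    nat_lt.comp (const 0) (primrec_top hc)
  have h2 : PrimrecPred fun c : ℕ × ℕ × ℕ × ℕ => ∀ e x y, codedEval c e x y →
      x ≤ c.2.1 ∧ y ≤ c.2.1 :=
    primrecPred_forall_codedEval hc ((nat_le.comp hx3 hM3).and (nat_le.comp hy3 hM3))
  have h3 : PrimrecPred fun c : ℕ × ℕ × ℕ × ℕ => ∀ e x y, codedEval c e x y →
      EvalRule c.2.1 (codedEval c) (codedFin c) e x y :=
    primrecPred_forall_codedEval hc (primrecPred_evalRule hc3 he3 hx3 hy3)
  have h4 : PrimrecPred fun c : ℕ × ℕ × ℕ × ℕ => ∀ e, codedFin c e →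
      FinRule c.2.1 (codedEval c) (codedFin c) e :=
    primrecPred_forall fst (primrecPred_imp (primrecPred_codedFin fst snd)
      (primrecPred_finRule fst snd)) fun c e h h' => absurd h'.1 (not_lt_of_ge h)
  have h5 : PrimrecPred fun c : ℕ × ℕ × ℕ × ℕ => ∀ e x y, codedEval c e x y →
      ∀ e' x' y', codedEval c e' x' y' → e' = e → e.unpair.1 = 0 → x ≤ x' → y ≤ y' := by
    refine primrecPred_forall_codedEval hc (primrecPred_forall_codedEval hc3 ?_)
    have hl : Primrec fun q : ((γ × ℕ) × ℕ) × ℕ => q.1.1.1 := fst.comp (fst.comp fst)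
    exact primrecPred_imp (Primrec.eq.comp (snd.comp (fst.comp fst)) (he3.comp hl))
      (primrecPred_imp (hvar3.comp hl) (primrecPred_imp (nat_le.comp (hx3.comp hl) (snd.comp fst))
        (nat_le.comp (hy3.comp hl) snd)))
  have h6 : PrimrecPred fun c : ℕ × ℕ × ℕ × ℕ => ∀ e x y, codedEval c e x y →
      x = 0 → e.unpair.1 = 0 → y = 0 :=
    primrecPred_forall_codedEval hc (primrecPred_imp (Primrec.eq.comp hx3 (const 0))
      (primrecPred_imp hvar3 (Primrec.eq.comp hy3 (const 0))))
  have h7 : PrimrecPred fun c : ℕ × ℕ × ℕ × ℕ => ∀ e x y, codedEval c e x y →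
      codedFin c e → e.unpair.1 = 0 → x < c.2.1 → y < c.2.1 :=
    primrecPred_forall_codedEval hc (primrecPred_imp (primrecPred_codedFin hc3 he3)
      (primrecPred_imp hvar3 (primrecPred_imp (nat_lt.comp hx3 hM3) (nat_lt.comp hy3 hM3))))
  refine (h1.and (h2.and (h3.and (h4.and (h5.and (h6.and h7)))))).of_eq fun c => ?_
  constructor
  · rintro ⟨h1, h2, h3, h4, h5, h6, h7⟩
    exact ⟨h1, h2, h3, h4, fun e x y x' y' h h' => h5 e x y h e x' y' h' rfl,
      fun e y h => h6 e 0 y h rfl, h7⟩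
  · intro h
    exact ⟨h.top_pos, h.le_top, h.evalRule, h.finRule,
      fun e x y h1 e' x' y' h2 he => h.var_mono e x y x' y' h1 (he ▸ h2),
      fun e x y h1 hx => h.var_zero e y (hx ▸ h1), h.var_fin⟩

/-- A bound on the numbers needed in a certificate about the codes `p.1` and `p.2`. -/
def certBound (p : ℕ × ℕ) : ℕ := 2 * (4 ^ p.1 + 4 ^ p.2) + 2

/-- Some certificate of bounded size satisfies `R`. -/
def ExistsCode (R : ℕ × ℕ → ℕ × ℕ × ℕ × ℕ → Prop) (p : ℕ × ℕ) : Prop :=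
  ∃ M < certBound p, ∃ g < 2 ^ Nat.pair (certBound p) (Nat.pair (certBound p) (certBound p)),
    ∃ k < 2 ^ certBound p, CodesCertificate (certBound p, M, g, k) ∧ R p (certBound p, M, g, k)

lemma primrec_certBound : Primrec certBound :=
  nat_add.comp (nat_mul.comp (const 2)
    (nat_add.comp (primrec_pow (const 4) fst) (primrec_pow (const 4) snd))) (const 2)

lemma primrecPred_existsCode {R : ℕ × ℕ → ℕ × ℕ × ℕ × ℕ → Prop} (hR : PrimrecRel R) :
    PrimrecPred (ExistsCode R) := by
  have hN := primrec_certBound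
  have hK := primrec_pow (const 2) (Primrec₂.natPair.comp hN (Primrec₂.natPair.comp hN hN))
  refine primrecPred_exists_lt hN (primrecPred_exists_lt (hK.comp fst)
    (primrecPred_exists_lt ((primrec_pow (const 2) hN).comp (fst.comp fst)) ?_))
  have hp : Primrec fun q : ((((ℕ × ℕ) × ℕ) × ℕ) × ℕ) => q.1.1.1 := fst.comp (fst.comp fst)
  have hc : Primrec fun q : ((((ℕ × ℕ) × ℕ) × ℕ) × ℕ) =>
      (certBound q.1.1.1, q.1.1.2, q.1.2, q.2) :=
    (hN.comp hp).pair ((snd.comp (fst.comp fst)).pair ((snd.comp fst).pair snd))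
  exact (primrecPred_codesCertificate.comp hc).and (hR.comp hp hc)

end Primrec

/-- The certificate `c` records values of both codes. -/
def RecordsValues (p : ℕ × ℕ) (c : ℕ × ℕ × ℕ × ℕ) : Prop :=
  (∃ x y, codedEval c p.1 x y) ∧ ∃ x y, codedEval c p.2 x y

/-- The certificate `c` records distinct values of the two codes at some argument. -/
def RecordsDistinct (p : ℕ × ℕ) (c : ℕ × ℕ × ℕ × ℕ) : Prop :=
  ∃ x y z, codedEval c p.1 x y ∧ codedEval c p.2 x z ∧ y ≠ z

section Primrec

open Primrec

lemma primrecRel_recordsValues : PrimrecRel RecordsValues := by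
  have key : ∀ {e : (ℕ × ℕ) × (ℕ × ℕ × ℕ × ℕ) → ℕ}, Primrec e →
      PrimrecPred fun b : (ℕ × ℕ) × (ℕ × ℕ × ℕ × ℕ) => ∃ x y, codedEval b.2 (e b) x y := by
    intro e he
    have hN : Primrec fun b : (ℕ × ℕ) × (ℕ × ℕ × ℕ × ℕ) => b.2.1 := fst.comp snd
    refine primrecPred_exists hN ?_ fun b x ⟨_, h⟩ => h.1.2.1
    refine primrecPred_exists (hN.comp fst) ?_ fun b y h => h.1.2.2
    exact primrecPred_codedEval (snd.comp (fst.comp fst)) (he.comp (fst.comp fst))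
      (snd.comp fst) snd
  exact (key (fst.comp fst)).and (key (snd.comp fst))

lemma primrecRel_recordsDistinct : PrimrecRel RecordsDistinct := by
  have hN : Primrec fun b : (ℕ × ℕ) × (ℕ × ℕ × ℕ × ℕ) => b.2.1 := fst.comp snd
  refine primrecPred_exists hN ?_ fun b x ⟨_, _, h, _⟩ => h.1.2.1
  refine primrecPred_exists (hN.comp fst) ?_ fun b y ⟨_, h, _⟩ => h.1.2.2
  refine primrecPred_exists (hN.comp (fst.comp fst)) ?_ fun b z ⟨_, h, _⟩ => h.1.2.2
  have hp : Primrec fun q : ((((ℕ × ℕ) × (ℕ × ℕ × ℕ × ℕ)) × ℕ) × ℕ) × ℕ => q.1.1.1 :=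
    fst.comp (fst.comp fst)
  have hx : Primrec fun q : ((((ℕ × ℕ) × (ℕ × ℕ × ℕ × ℕ)) × ℕ) × ℕ) × ℕ => q.1.1.2 :=
    snd.comp (fst.comp fst)
  have hy : Primrec fun q : ((((ℕ × ℕ) × (ℕ × ℕ × ℕ × ℕ)) × ℕ) × ℕ) × ℕ => q.1.2 :=
    snd.comp fst
  exact (primrecPred_codedEval (snd.comp hp) (fst.comp (fst.comp hp)) hx hy).and
    ((primrecPred_codedEval (snd.comp hp) (snd.comp (fst.comp hp)) hx snd).and
      (Primrec.eq.comp hy snd).not)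

end Primrec

/-- The values of two terms at an argument are recorded, faithfully as far as their equality is
concerned, by a certificate of bounded size. -/
lemma existsCode_of_eval {h : ℕ → ℕ∞ → ℕ∞} (hh : ∀ i, IsTimeWarp (h i)) (s t : Term) (x : ℕ∞)
    {R : ℕ × ℕ → ℕ × ℕ × ℕ × ℕ → Prop}
    (hR : ∀ c a y z, codedEval c s.encode a y → codedEval c t.encode a z →
      (y = z → eval h s x = eval h t x) → R (s.encode, t.encode) c) :
    ExistsCode R (s.encode, t.encode) := by
  obtain ⟨T, U, hT, hs⟩ := (exists_isTrace hh s).1 x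
  obtain ⟨T', U', hT', ht⟩ := (exists_isTrace hh t).1 x
  obtain ⟨M, V, F, hC, hM, hV, hF, c, hc, hinj⟩ := IsTrace.exists_isCertificate hh
    ((hT.weaken (le_max_left s.encode t.encode) le_rfl).union
      (hT'.weaken (le_max_right s.encode t.encode) le_rfl))
  have hs' := Finset.mem_union_left T' hs
  have ht' := Finset.mem_union_right T ht
  have hMN : M < certBound (s.encode, t.encode) := by
    simp only [certBound]
    omega
  have hBN : max s.encode t.encode < certBound (s.encode, t.encode) := by
    have h1 : s.encode < 4 ^ s.encode := Nat.lt_pow_self (by norm_num)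
    have h2 : t.encode < 4 ^ t.encode := Nat.lt_pow_self (by norm_num)
    simp only [certBound]
    omega
  obtain ⟨g, hg, k, hk, hgV, hkF⟩ := exists_coded (N := certBound (s.encode, t.encode))
    (fun e x y he => ⟨(hV e x y he).trans_lt hBN, (hC.le_top e x y he).1.trans_lt hMN,
      (hC.le_top e x y he).2.trans_lt hMN⟩) (fun e he => (hF e he).trans_lt hBN) M
  refine ⟨M, hMN, g, hg, k, hk, ?_, hR _ (c x) _ _ (hgV ▸ hc _ _ _ hs') (hgV ▸ hc _ _ _ ht')
    (hinj _ _ _ _ _ _ hs' ht')⟩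
  rw [CodesCertificate, hgV, hkF]
  exact hC

lemma existsCode_recordsValues_iff (p : ℕ × ℕ) :
    ExistsCode RecordsValues p ↔ ∃ s t : Term, p.1 = s.encode ∧ p.2 = t.encode := by
  constructor
  · rintro ⟨M, _, g, _, k, _, hC, ⟨x, y, h⟩, ⟨x', y', h'⟩⟩
    obtain ⟨s, hs⟩ := IsCertificate.exists_encode_eq hC _ _ _ h
    obtain ⟨t, ht⟩ := IsCertificate.exists_encode_eq hC _ _ _ h'
    exact ⟨s, t, hs, ht⟩
  · obtain ⟨a, b⟩ := p
    rintro ⟨s, t, rfl, rfl⟩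
    exact existsCode_of_eval (fun _ => IsTimeWarp.id) s t 0
      fun c x y z h h' _ => ⟨⟨x, y, h⟩, ⟨x, z, h'⟩⟩

lemma existsCode_recordsDistinct_iff (s t : Term) :
    ExistsCode RecordsDistinct (s.encode, t.encode) ↔
      ∃ h : ℕ → ℕ∞ → ℕ∞, (∀ i, PreservesSSup (h i)) ∧ eval h s ≠ eval h t := by
  constructor
  · rintro ⟨M, _, g, _, k, _, hC, x, y, z, h, h', hne⟩
    refine ⟨_, fun i => (IsCertificate.isTimeWarp_extendSamples hC
      (e := Nat.pair 0 i) (by simp)).preservesSSup, fun heq => hne ?_⟩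
    have hy := (IsCertificate.le_top hC _ _ _ h).2
    have hz := (IsCertificate.le_top hC _ _ _ h').2
    have key := (IsCertificate.sound hC s).1 x y h
    rw [heq, (IsCertificate.sound hC t).1 x z h'] at key
    exact le_antisymm ((decodeTop_le_iff hy hz).1 key.ge) ((decodeTop_le_iff hz hy).1 key.le)
  · rintro ⟨h, hh, hne⟩
    obtain ⟨x, hx⟩ := Function.ne_iff.1 hne
    exact existsCode_of_eval (fun i => (hh i).isTimeWarp) s t x
      fun c a y z hy hz hyz => ⟨a, y, z, hy, hz, fun e => hx (hyz e)⟩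

/-- The equational theory of the time warp algebra is decidable: with respect to the
canonical encoding of terms as natural numbers, the predicate "the pair encodes terms
`s`, `t` such that `eval h s = eval h t` for every assignment `h` of time warps to
variables" is computable. -/
theorem stmt18 :
    ComputablePred (fun p : ℕ × ℕ =>
      ∃ s t : Term, p.1 = Term.encode s ∧ p.2 = Term.encode t ∧
        ∀ h : ℕ → ℕ∞ → ℕ∞, (∀ i, PreservesSSup (h i)) → eval h s = eval h t) := by
  refine ((primrecPred_existsCode primrecRel_recordsValues).and
    (primrecPred_existsCode primrecRel_recordsDistinct).not).computablePred.of_eq ?_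
  rintro ⟨a, b⟩
  rw [existsCode_recordsValues_iff]
  constructor
  · rintro ⟨⟨s, t, rfl, rfl⟩, hn⟩
    rw [existsCode_recordsDistinct_iff] at hn
    push Not at hn
    exact ⟨s, t, rfl, rfl, hn⟩
  · rintro ⟨s, t, rfl, rfl, hst⟩
    refine ⟨⟨s, t, rfl, rfl⟩, ?_⟩
    rw [existsCode_recordsDistinct_iff]
    push Not
    exact hst
end

section
/- Let P = {n : ℕ | n ≥ 1}. For a time warp f, let R_f := {(x, y) ∈ P × P | (x : ℕ∞) ≤ f y}. Then: (i) R_f is a weakening relation for every time warp f, and f ↦ R_f is a bijection from the set of time warps onto the set of weakening relations on P; (ii) for all time warps f, g: f ≤ g pointwise if, and only if, R_f ⊆ R_g; (iii) R_{f ∘ g} = R_f ∗ R_g, where (R ∗ S) := {(x, z) | ∃ y ∈ P, (x,y) ∈ R and (y,z) ∈ S}; (iv) R_{f⋆} = (P × P) \ (R_f)⁻¹, the complement of the converse relation of R_f. -/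
/-- The positive natural numbers. -/
def Pos : Type := {n : ℕ // 1 ≤ n}

/-- A weakening (monotone) relation on `P`. -/
def IsWeakRel (R : Set (Pos × Pos)) : Prop :=
  ∀ x x' y y' : Pos, x'.1 ≤ x.1 → (x, y) ∈ R → y.1 ≤ y'.1 → (x', y') ∈ R

/-- The relation `R_f = {(x, y) ∈ P × P | x ≤ f y}` associated with a time warp `f`. -/
def Rrel (f : ℕ∞ → ℕ∞) : Set (Pos × Pos) :=
  {p | (p.1.1 : ℕ∞) ≤ f (p.2.1 : ℕ∞)}

theorem exists_natCast_le_of_le_sSup {n : ℕ} (hn : 1 ≤ n) {S : Set ℕ∞}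
    (h : (n : ℕ∞) ≤ sSup S) : ∃ s ∈ S, (n : ℕ∞) ≤ s := by
  obtain ⟨k, rfl⟩ := Nat.exists_eq_add_of_le' hn
  obtain ⟨s, hs, hks⟩ := lt_sSup_iff.1
    (lt_of_lt_of_le (Nat.cast_lt.2 (Nat.lt_succ_self k) : (k : ℕ∞) < ((k + 1 : ℕ) : ℕ∞)) h)
  refine ⟨s, hs, ?_⟩
  push_cast
  exact Order.add_one_le_of_lt hks

namespace PreservesSSup

theorem monotone {f : ℕ∞ → ℕ∞} (hf : PreservesSSup f) : Monotone f := by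
  intro a b hab
  have h := hf {a, b}
  rw [sSup_pair, sup_eq_right.2 hab] at h
  exact h ▸ le_sSup (Set.mem_image_of_mem f (Set.mem_insert a {b}))

theorem map_zero {f : ℕ∞ → ℕ∞} (hf : PreservesSSup f) : f 0 = 0 := by
  have h := hf ∅
  simpa using h

theorem exists_pos_le {f : ℕ∞ → ℕ∞} (hf : PreservesSSup f) {n : ℕ} (hn : 1 ≤ n) {m : ℕ∞}
    (h : (n : ℕ∞) ≤ f m) :
    ∃ y : Pos, (y.1 : ℕ∞) ≤ m ∧ (n : ℕ∞) ≤ f (y.1 : ℕ∞) := by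
  have hm : m = sSup {a : ℕ∞ | ∃ k : ℕ, a = k ∧ a ≤ m} := by
    refine le_antisymm ?_ (sSup_le fun a ⟨_, _, ha⟩ => ha)
    exact ENat.forall_natCast_le_iff_le.1 fun k hk => le_sSup ⟨k, rfl, hk⟩
  rw [hm, hf] at h
  obtain ⟨_, ⟨_, ⟨k, rfl, hk⟩, rfl⟩, hnk⟩ := exists_natCast_le_of_le_sSup hn h
  refine ⟨⟨k, Nat.one_le_iff_ne_zero.2 ?_⟩, hk, hnk⟩
  rintro rfl
  rw [Nat.cast_zero, hf.map_zero] at hnk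
  have : n ≤ 0 := by exact_mod_cast hnk
  lia

theorem isWeakRel_Rrel {f : ℕ∞ → ℕ∞} (hf : PreservesSSup f) : IsWeakRel (Rrel f) :=
  fun _ _ _ _ hx h hy =>
    (Nat.cast_le.2 hx).trans (le_trans h (hf.monotone (Nat.cast_le.2 hy)))

theorem le_iff_Rrel_subset {f g : ℕ∞ → ℕ∞} (hf : PreservesSSup f) (hg : PreservesSSup g) :
    (∀ x, f x ≤ g x) ↔ Rrel f ⊆ Rrel g := by
  refine ⟨fun h _ hp => le_trans hp (h _), fun h x => ?_⟩
  refine ENat.forall_natCast_le_iff_le.1 fun n hn => ?_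
  rcases Nat.eq_zero_or_pos n with rfl | hpos
  · simp
  · obtain ⟨y, hy, hny⟩ := hf.exists_pos_le hpos hn
    have hmem : ((⟨n, hpos⟩, y) : Pos × Pos) ∈ Rrel g := h hny
    exact le_trans hmem (hg.monotone hy)

theorem Rrel_comp {f g : ℕ∞ → ℕ∞} (hf : PreservesSSup f) :
    Rrel (f ∘ g) = {p | ∃ y : Pos, (p.1, y) ∈ Rrel f ∧ (y, p.2) ∈ Rrel g} := by
  ext ⟨x, z⟩
  constructor
  · intro h
    obtain ⟨y, hy, hxy⟩ := hf.exists_pos_le x.2 h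
    exact ⟨y, hxy, hy⟩
  · rintro ⟨y, hxy, hyz⟩
    exact le_trans hxy (hf.monotone hyz)

end PreservesSSup

/-- The time warp `m ↦ ⨆ {x | (x, y) ∈ R, y ≤ m}` associated with a relation `R` on `P`. -/
noncomputable def warpOfRel (R : Set (Pos × Pos)) (m : ℕ∞) : ℕ∞ :=
  sSup {a | ∃ p ∈ R, a = (p.1.1 : ℕ∞) ∧ (p.2.1 : ℕ∞) ≤ m}

theorem preservesSSup_warpOfRel (R : Set (Pos × Pos)) : PreservesSSup (warpOfRel R) := by
  intro S
  apply le_antisymm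
  · refine sSup_le ?_
    rintro _ ⟨p, hp, rfl, hpS⟩
    obtain ⟨s, hs, hps⟩ := exists_natCast_le_of_le_sSup p.2.2 hpS
    exact le_sSup_of_le (Set.mem_image_of_mem _ hs) (le_sSup ⟨p, hp, rfl, hps⟩)
  · refine sSup_le ?_
    rintro _ ⟨s, hs, rfl⟩
    refine sSup_le_sSup ?_
    rintro _ ⟨p, hp, rfl, hps⟩
    exact ⟨p, hp, rfl, hps.trans (le_sSup hs)⟩

theorem IsWeakRel.Rrel_warpOfRel {R : Set (Pos × Pos)} (hR : IsWeakRel R) :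
    Rrel (warpOfRel R) = R := by
  ext ⟨x, y⟩
  constructor
  · intro h
    obtain ⟨_, ⟨p, hp, rfl, hpy⟩, hxp⟩ := exists_natCast_le_of_le_sSup x.2 h
    exact hR p.1 x p.2 y (Nat.cast_le.1 hxp) hp (Nat.cast_le.1 hpy)
  · intro h
    change (x.1 : ℕ∞) ≤ warpOfRel R y.1
    exact le_sSup ⟨(x, y), h, rfl, le_rfl⟩

theorem natCast_le_wpred {k : ℕ} {m : ℕ∞} (h : (k : ℕ∞) < m) : (k : ℕ∞) ≤ wpred m := by
  induction m with
  | top => simp [wpred]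
  | coe n =>
    have hkn : k < n := Nat.cast_lt.1 h
    simp only [wpred, ENat.natCast_ne_top, if_false, ENat.toNat_natCast, Nat.cast_le]
    lia

theorem wpred_natCast_lt {n : ℕ} (hn : 1 ≤ n) : wpred n < n := by
  simp only [wpred, ENat.natCast_ne_top, if_false, ENat.toNat_natCast, Nat.cast_lt]
  lia

theorem Monotone.Rrel_winv {f : ℕ∞ → ℕ∞} (hf : Monotone f) :
    Rrel (winv f) = {p | (p.2, p.1) ∉ Rrel f} := by
  ext ⟨x, y⟩
  constructor
  · intro h hyx
    have hle : winv f (y.1 : ℕ∞) ≤ wpred (x.1 : ℕ∞) := sInf_le ⟨_, hyx, rfl⟩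
    exact absurd (wpred_natCast_lt x.2) (not_lt.2 (le_trans h hle))
  · intro h
    change (x.1 : ℕ∞) ≤ winv f y.1
    refine le_sInf ?_
    rintro _ ⟨n, hn, rfl⟩
    refine natCast_le_wpred (lt_of_not_ge fun hnx => h ?_)
    exact hn.trans (hf hnx)

theorem stmt19 :
    (∀ f : ℕ∞ → ℕ∞, PreservesSSup f → IsWeakRel (Rrel f)) ∧
    (∀ f g : ℕ∞ → ℕ∞, PreservesSSup f → PreservesSSup g → Rrel f = Rrel g → f = g) ∧
    (∀ R : Set (Pos × Pos), IsWeakRel R →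
      ∃ f : ℕ∞ → ℕ∞, PreservesSSup f ∧ Rrel f = R) ∧
    (∀ f g : ℕ∞ → ℕ∞, PreservesSSup f → PreservesSSup g →
      ((∀ x, f x ≤ g x) ↔ Rrel f ⊆ Rrel g)) ∧
    (∀ f g : ℕ∞ → ℕ∞, PreservesSSup f → PreservesSSup g →
      Rrel (f ∘ g) = {p | ∃ y : Pos, (p.1, y) ∈ Rrel f ∧ (y, p.2) ∈ Rrel g}) ∧
    (∀ f : ℕ∞ → ℕ∞, PreservesSSup f →
      Rrel (winv f) = {p | (p.2, p.1) ∉ Rrel f}) := by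
  refine ⟨fun f hf => hf.isWeakRel_Rrel, fun f g hf hg h => ?_,
    fun R hR => ⟨warpOfRel R, preservesSSup_warpOfRel R, hR.Rrel_warpOfRel⟩,
    fun f g hf hg => hf.le_iff_Rrel_subset hg, fun f g hf _ => hf.Rrel_comp,
    fun f hf => hf.monotone.Rrel_winv⟩
  exact funext fun x => le_antisymm ((hf.le_iff_Rrel_subset hg).2 h.subset x)
    ((hg.le_iff_Rrel_subset hf).2 h.symm.subset x)
end
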